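/- Let {S_n}_{n≥0} and {S'_n}_{n≥0} be two independent elephant random walks on ℤ with memory parameters p and p' respectively (and arbitrary initial parameters q, q'). If 0 < p < 3/4 and 0 < p' < 3/4, then almost surely limsup_{n→∞} (S_n − S'_n)/√(2 n log log n) = √(1/(3−4p) + 1/(3−4p')), and almost surely limsup_{n→∞} (S'_n − S_n)/√(2 n log log n) = √(1/(3−4p) + 1/(3−4p')). -/

import Mathlib

open MeasureTheory ProbabilityTheory Filter Asymptotics

noncomputable section

/-- The step sequence `X 0, X 1, X 2, …` (with `X i` the `(i+1)`-th step) of an elephant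
random walk on `ℤ` with memory parameter `p` and initial parameter `q`: the steps take
values in `{+1, -1}`, the first step is `+1` with probability `q` and `-1` with
probability `1 - q`, and the conditional law of each further step given the past is
`P(X_{n+1} = x | X_1,…,X_n) = (1/n) ∑_{i=1}^n (p·1{X_i = x} + (1-p)·1{X_i = -x})`,
expressed via the resulting finite-dimensional distributions. -/
def IsERW {Ω : Type*} [MeasurableSpace Ω] (P : Measure Ω) (p q : ℝ)
    (X : ℕ → Ω → ℤ) : Prop :=
  (∀ n, Measurable (X n)) ∧
  (∀ n ω, X n ω = 1 ∨ X n ω = -1) ∧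
  ∀ (n : ℕ) (ε : ℕ → ℤ), (∀ i, ε i = 1 ∨ ε i = -1) →
    (P {ω | ∀ i ≤ n, X i ω = ε i}).toReal =
      (if ε 0 = 1 then q else 1 - q) *
        ∏ m ∈ Finset.range n,
          ((1 : ℝ) / (m + 1) *
            ∑ i ∈ Finset.range (m + 1),
              (p * (if ε i = ε (m + 1) then 1 else 0) +
                (1 - p) * (if ε i = -ε (m + 1) then 1 else 0)))

/-- `Past Y n f` says that `f` is a function of the first `n` terms `Y 0, …, Y (n-1)`. -/
def Past {Ω α β : Type*} (Y : ℕ → Ω → α) (n : ℕ) (f : Ω → β) : Prop :=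
  ∀ ω ω', (∀ i < n, Y i ω = Y i ω') → f ω = f ω'

namespace Past

variable {Ω α β γ δ : Type*} {Y : ℕ → Ω → α} {m n : ℕ}

lemma mono {f : Ω → β} (hf : Past Y m f) (hmn : m ≤ n) : Past Y n f :=
  fun ω ω' h => hf ω ω' fun i hi => h i (hi.trans_le hmn)

lemma const (b : β) : Past Y n (fun _ : Ω => b) := fun _ _ _ => rfl

lemma comp {f : Ω → β} (hf : Past Y n f) (g : β → γ) : Past Y n (fun ω => g (f ω)) :=
  fun ω ω' h => congrArg g (hf ω ω' h)

lemma comp₂ {f : Ω → β} {f' : Ω → γ} (hf : Past Y n f) (hf' : Past Y n f') (g : β → γ → δ) :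
    Past Y n (fun ω => g (f ω) (f' ω)) :=
  fun ω ω' h => congrArg₂ g (hf ω ω' h) (hf' ω ω' h)

lemma term {i : ℕ} (hi : i < n) : Past Y n (Y i) := fun _ _ h => h i hi

lemma sum {ι : Type*} [AddCommMonoid β] {s : Finset ι} {f : ι → Ω → β}
    (hf : ∀ i ∈ s, Past Y n (f i)) : Past Y n (fun ω => ∑ i ∈ s, f i ω) :=
  fun ω ω' h => Finset.sum_congr rfl fun i hi => hf i hi ω ω' h

lemma mul [Mul β] {f g : Ω → β} (hf : Past Y n f) (hg : Past Y n g) :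
    Past Y n (fun ω => f ω * g ω) := hf.comp₂ hg (· * ·)

lemma add [Add β] {f g : Ω → β} (hf : Past Y n f) (hg : Past Y n g) :
    Past Y n (fun ω => f ω + g ω) := hf.comp₂ hg (· + ·)

lemma sub [Sub β] {f g : Ω → β} (hf : Past Y n f) (hg : Past Y n g) :
    Past Y n (fun ω => f ω - g ω) := hf.comp₂ hg (· - ·)

lemma exists_eq_comp [Nonempty β] {f : Ω → β} (hf : Past Y n f) :
    ∃ g : (Fin n → α) → β, ∀ ω, f ω = g (fun i => Y i ω) := by
  have hfac : Function.FactorsThrough f (fun ω (i : Fin n) => Y i ω) := by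
    intro ω ω' h
    exact hf ω ω' fun i hi => congrFun h ⟨i, hi⟩
  obtain ⟨g, hg⟩ := (Function.factorsThrough_iff _).1 hfac
  exact ⟨g, fun ω => congrFun hg ω⟩

lemma measurable [MeasurableSpace Ω] {Y : ℕ → Ω → ℤ} (hY : ∀ n, Measurable (Y n))
    [Nonempty β] [MeasurableSpace β] {f : Ω → β} (hf : Past Y n f) : Measurable f := by
  obtain ⟨g, hg⟩ := hf.exists_eq_comp
  have : f = g ∘ fun ω (i : Fin n) => Y i ω := funext hg
  rw [this]
  exact (Measurable.of_discrete).comp (measurable_pi_lambda _ fun i => hY i)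

lemma integrable [MeasurableSpace Ω] {P : Measure Ω} [IsFiniteMeasure P] {Y : ℕ → Ω → ℤ}
    (hY : ∀ n, Measurable (Y n)) (hs : ∀ n ω, Y n ω = 1 ∨ Y n ω = -1)
    {f : Ω → ℝ} (hf : Past Y n f) : Integrable f P := by
  obtain ⟨g, hg⟩ := hf.exists_eq_comp
  have hfin : (Set.univ.pi fun _ : Fin n => ({1, -1} : Set ℤ)).Finite :=
    Set.Finite.pi fun _ => Set.toFinite _
  obtain ⟨C, hC⟩ := (hfin.image fun y => ‖g y‖).bddAbove
  refine Integrable.of_bound (hf.measurable hY).aestronglyMeasurable C (ae_of_all _ fun ω => ?_)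
  rw [hg ω]
  exact hC ⟨_, by intro i _; simpa using hs i ω, rfl⟩

end Past

/-- `Y` is a `±1`-valued sequence whose conditional mean given the past is `μ k` for `k ≥ k₀`. -/
structure IsSignSequence {Ω : Type*} [MeasurableSpace Ω] (P : Measure Ω) (k₀ : ℕ)
    (Y : ℕ → Ω → ℤ) (μ : ℕ → Ω → ℝ) : Prop where
  measurable : ∀ k, Measurable (Y k)
  sign : ∀ k ω, Y k ω = 1 ∨ Y k ω = -1
  past : ∀ k, Past Y k (μ k)
  abs_le : ∀ k ω, |μ k ω| ≤ 1
  mean : ∀ k, k₀ ≤ k → ∀ f : Ω → ℝ, Past Y k f →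
    ∫ ω, f ω * Y k ω ∂P = ∫ ω, f ω * μ k ω ∂P

/-- Hoeffding's lemma for a `±1`-valued variable with mean `u`. -/
lemma exp_mul_cosh_add_le (θ u : ℝ) (hu : |u| ≤ 1) :
    Real.exp (-(θ * u)) * (Real.cosh θ + u * Real.sinh θ) ≤ Real.exp (θ ^ 2 / 2) := by
  obtain ⟨h1, h2⟩ := abs_le.1 hu
  let ν : Measure ℝ := ENNReal.ofReal ((1 + u) / 2) • Measure.dirac 1 +
    ENNReal.ofReal ((1 - u) / 2) • Measure.dirac (-1)
  have hν : IsProbabilityMeasure ν := by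
    constructor
    simp only [ν, Measure.coe_add, Measure.coe_smul, Pi.add_apply, Pi.smul_apply, measure_univ,
      smul_eq_mul, mul_one]
    rw [← ENNReal.ofReal_add (by linarith) (by linarith)]
    ring_nf
    simp
  have h_int : ∀ f : ℝ → ℝ, ∫ x, f x ∂ν = (1 + u) / 2 * f 1 + (1 - u) / 2 * f (-1) := by
    intro f
    rw [integral_add_measure ((integrable_dirac (by simp)).smul_measure ENNReal.ofReal_ne_top)
      ((integrable_dirac (by simp)).smul_measure ENNReal.ofReal_ne_top), integral_smul_measure,
      integral_smul_measure, integral_dirac, integral_dirac, ENNReal.toReal_ofReal (by linarith),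
      ENNReal.toReal_ofReal (by linarith), smul_eq_mul, smul_eq_mul]
  have hmem : ∀ᵐ x ∂ν, id x ∈ Set.Icc (-1 : ℝ) 1 := by
    rw [ae_add_measure_iff]
    exact ⟨Measure.ae_smul_measure (by simp [ae_dirac_eq]) _,
      Measure.ae_smul_measure (by simp [ae_dirac_eq]) _⟩
  have h := (hasSubgaussianMGF_of_mem_Icc (μ := ν) (X := id) aemeasurable_id hmem).mgf_le θ
  rw [mgf, h_int] at h
  simp only [id, h_int] at h
  norm_num at h
  rw [Real.cosh_eq, Real.sinh_eq]
  calc _ = (1 + u) / 2 * Real.exp (θ * (1 - ((1 + u) / 2 + -((1 - u) / 2)))) +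
      (1 - u) / 2 * Real.exp (θ * (-1 - ((1 + u) / 2 + -((1 - u) / 2)))) := by
        rw [show θ * (1 - ((1 + u) / 2 + -((1 - u) / 2))) = -(θ * u) + θ by ring,
          show θ * (-1 - ((1 + u) / 2 + -((1 - u) / 2))) = -(θ * u) + -θ by ring,
          Real.exp_add, Real.exp_add]
        ring
    _ ≤ _ := h

lemma exp_le_exp_mul_cosh_add {s : ℝ} (hs : 0 < s) :
    ∃ θ₀ > 0, ∀ θ u : ℝ, |θ| ≤ θ₀ → |u| ≤ 1 →
      Real.exp (θ ^ 2 / 2 * (1 - s - u ^ 2)) ≤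
        Real.exp (-(θ * u)) * (Real.cosh θ + u * Real.sinh θ) := by
  refine ⟨min s 1 / 8, by positivity, fun θ u hθ hu => ?_⟩
  set r := min s 1 with hr
  have hr0 : 0 < r := by positivity
  have hr1 : r ≤ 1 := min_le_right _ _
  have hrs : r ≤ s := min_le_left _ _
  obtain ⟨h1, h2⟩ := abs_le.1 hu
  have hlow : ∀ x : ℝ, |x| ≤ 2 * |θ| → 1 + x + x ^ 2 / 2 - 2 * |θ| ^ 3 ≤ Real.exp x := by
    intro x hx
    have hb := Real.exp_bound (x := x) (by linarith) (n := 3) (by norm_num)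
    norm_num [Finset.sum_range_succ, Nat.factorial] at hb
    have h3 : |x| ^ 3 ≤ (2 * |θ|) ^ 3 := by gcongr
    have := (abs_le.1 hb).1
    have h0 : 0 ≤ |θ| ^ 3 := by positivity
    nlinarith
  have hA := hlow (θ * (1 - u)) (by
    rw [abs_mul, abs_of_nonneg (by linarith : 0 ≤ 1 - u)]; nlinarith [abs_nonneg θ])
  have hB := hlow (θ * (-1 - u)) (by
    rw [abs_mul, abs_of_nonpos (by linarith : -1 - u ≤ 0)]; nlinarith [abs_nonneg θ])
  have hrhs : Real.exp (-(θ * u)) * (Real.cosh θ + u * Real.sinh θ) =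
      (1 + u) / 2 * Real.exp (θ * (1 - u)) + (1 - u) / 2 * Real.exp (θ * (-1 - u)) := by
    rw [Real.cosh_eq, Real.sinh_eq, show θ * (1 - u) = -(θ * u) + θ by ring,
      show θ * (-1 - u) = -(θ * u) + -θ by ring, Real.exp_add, Real.exp_add]
    ring
  have hge : 1 + θ ^ 2 * (1 - u ^ 2) / 2 - 2 * |θ| ^ 3 ≤
      Real.exp (-(θ * u)) * (Real.cosh θ + u * Real.sinh θ) := by
    rw [hrhs]
    have e1 := mul_le_mul_of_nonneg_left hA (by linarith : 0 ≤ (1 + u) / 2)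
    have e2 := mul_le_mul_of_nonneg_left hB (by linarith : 0 ≤ (1 - u) / 2)
    refine le_trans (le_of_eq ?_) (add_le_add e1 e2)
    ring
  refine le_trans ?_ hge
  set y := θ ^ 2 / 2 * (1 - r - u ^ 2) with hy
  have hθ1 : |θ| ≤ 1 := by linarith
  have ht : θ ^ 2 = |θ| ^ 2 := (sq_abs θ).symm
  have hyb : |y| ≤ θ ^ 2 / 2 := by
    rw [hy, abs_mul, abs_of_nonneg (by positivity : 0 ≤ θ ^ 2 / 2)]
    refine mul_le_of_le_one_right (by positivity) (abs_le.2 ⟨?_, ?_⟩) <;> nlinarith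
  have hy1 : |y| ≤ 1 := by nlinarith [abs_nonneg θ]
  have hexp : Real.exp y ≤ 1 + y + y ^ 2 := by
    have := (abs_le.1 (Real.abs_exp_sub_one_sub_id_le hy1)).2
    linarith
  have hy2 : y ^ 2 ≤ (θ ^ 2 / 2) ^ 2 := sq_le_sq' (neg_le_of_abs_le hyb) (le_of_abs_le hyb)
  calc Real.exp (θ ^ 2 / 2 * (1 - s - u ^ 2)) ≤ Real.exp y := by
        apply Real.exp_le_exp.2; rw [hy]; gcongr
    _ ≤ 1 + y + (θ ^ 2 / 2) ^ 2 := by linarith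
    _ ≤ _ := by
      rw [hy, ht]
      have h0 := abs_nonneg θ
      have : |θ| ^ 2 * (|θ| ^ 2 / 4 + 2 * |θ|) ≤ |θ| ^ 2 * (r / 2) := by
        gcongr
        nlinarith
      nlinarith

namespace IsSignSequence

variable {Ω : Type*} [MeasurableSpace Ω] {P : Measure Ω} {k₀ : ℕ}
  {Y : ℕ → Ω → ℤ} {μ : ℕ → Ω → ℝ}

lemma past_sum (h : IsSignSequence P k₀ Y μ) {c : ℕ → Ω → ℝ} (hc : ∀ k, Past Y k (c k))
    (s : Finset ℕ) {n : ℕ} (hs : ∀ k ∈ s, k < n) :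
    Past Y n (fun ω => ∑ k ∈ s, c k ω * (Y k ω - μ k ω)) :=
  Past.sum fun k hk => ((hc k).mono (hs k hk).le).mul
    (((Past.term (hs k hk)).comp _).sub ((h.past k).mono (hs k hk).le))

variable [IsProbabilityMeasure P]

lemma integrable (h : IsSignSequence P k₀ Y μ) {n : ℕ} {f : Ω → ℝ} (hf : Past Y n f) :
    Integrable f P := hf.integrable h.measurable h.sign

lemma integral_mul_exp (h : IsSignSequence P k₀ Y μ) {k : ℕ} (hk : k₀ ≤ k) {f θ : Ω → ℝ}
    (hf : Past Y k f) (hθ : Past Y k θ) :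
    ∫ ω, f ω * Real.exp (θ ω * (Y k ω - μ k ω)) ∂P =
      ∫ ω, f ω * (Real.exp (-(θ ω * μ k ω)) *
        (Real.cosh (θ ω) + μ k ω * Real.sinh (θ ω))) ∂P := by
  have hμ := h.past k
  have hg : Past Y k (fun ω => f ω * Real.exp (-(θ ω * μ k ω))) :=
    hf.mul ((hθ.mul hμ).comp fun x => Real.exp (-x))
  have hc := hg.mul (hθ.comp Real.cosh)
  have hs := hg.mul (hθ.comp Real.sinh)
  have hexp : ∀ ω, f ω * Real.exp (θ ω * (Y k ω - μ k ω)) =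
      f ω * Real.exp (-(θ ω * μ k ω)) * Real.cosh (θ ω) +
        f ω * Real.exp (-(θ ω * μ k ω)) * Real.sinh (θ ω) * Y k ω := by
    intro ω
    rw [show θ ω * (Y k ω - μ k ω) = -(θ ω * μ k ω) + θ ω * Y k ω by ring, Real.exp_add]
    rcases h.sign k ω with hy | hy
    · rw [hy, Int.cast_one, mul_one, ← Real.cosh_add_sinh (θ ω)]; ring
    · rw [hy, Int.cast_neg, Int.cast_one, mul_neg, mul_one, ← Real.cosh_sub_sinh (θ ω)]; ring
  have hY : Past Y (k + 1) (fun ω => (Y k ω : ℝ)) :=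
    (Past.term (Nat.lt_succ_self k)).comp _
  simp_rw [hexp]
  rw [integral_add (h.integrable hc) (h.integrable ((hs.mono k.le_succ).mul hY)),
    h.mean k hk _ hs, ← integral_add (h.integrable hc) (h.integrable (hs.mul hμ))]
  refine integral_congr_ae (ae_of_all _ fun ω => ?_)
  simp only
  ring

/-- Exponential moments of a martingale transform, weighted by a function of the past. -/
lemma integral_mul_exp_sum_le (h : IsSignSequence P k₀ Y μ) {m n : ℕ} (hm : k₀ ≤ m) (hmn : m ≤ n)
    {f : Ω → ℝ} (hf : Past Y m f) (hf0 : ∀ ω, 0 ≤ f ω) {c : ℕ → Ω → ℝ}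
    (hc : ∀ k, Past Y k (c k)) {b : ℕ → ℝ} (hb : ∀ k ω, |c k ω| ≤ b k) :
    ∫ ω, f ω * Real.exp (∑ k ∈ Finset.Ico m n, c k ω * (Y k ω - μ k ω)) ∂P ≤
      Real.exp ((∑ k ∈ Finset.Ico m n, b k ^ 2) / 2) * ∫ ω, f ω ∂P := by
  induction n, hmn using Nat.le_induction with
  | base => simp
  | succ n hmn ih =>
    have hS := h.past_sum hc (Finset.Ico m n) fun k hk => (Finset.mem_Ico.1 hk).2
    have hg := (hf.mono hmn).mul (hS.comp Real.exp)
    have hμ := h.past n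
    simp_rw [Finset.sum_Ico_succ_top hmn, Real.exp_add, ← mul_assoc, add_div]
    rw [h.integral_mul_exp (hm.trans hmn) hg (hc n), Real.exp_add, mul_comm (Real.exp _),
      mul_assoc]
    refine le_trans ?_ (mul_le_mul_of_nonneg_left ih (Real.exp_nonneg _))
    rw [← integral_const_mul]
    refine integral_mono (h.integrable (hg.mul ?_)) ((h.integrable hg).const_mul _) fun ω => ?_
    · exact (((hc n).mul hμ).comp fun x => Real.exp (-x)).mul
        (((hc n).comp Real.cosh).add (hμ.mul ((hc n).comp Real.sinh)))
    · simp only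
      rw [mul_comm (Real.exp (b n ^ 2 / 2))]
      refine mul_le_mul_of_nonneg_left ((exp_mul_cosh_add_le _ _ (h.abs_le n ω)).trans ?_)
        (mul_nonneg (hf0 ω) (Real.exp_nonneg _))
      refine Real.exp_le_exp.2 (div_le_div_of_nonneg_right ?_ two_pos.le)
      exact sq_le_sq' (neg_le_of_abs_le (hb n ω)) (le_of_abs_le (hb n ω))

lemma le_integral_mul_exp_sum (h : IsSignSequence P k₀ Y μ) {m n : ℕ} (hm : k₀ ≤ m) (hmn : m ≤ n)
    {f : Ω → ℝ} (hf : Past Y m f) (hf0 : ∀ ω, 0 ≤ f ω) {c : ℕ → ℝ} {s θ₀ : ℝ}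
    (hθ₀ : ∀ θ u : ℝ, |θ| ≤ θ₀ → |u| ≤ 1 → Real.exp (θ ^ 2 / 2 * (1 - s - u ^ 2)) ≤
        Real.exp (-(θ * u)) * (Real.cosh θ + u * Real.sinh θ))
    (hc : ∀ k ∈ Finset.Ico m n, |c k| ≤ θ₀) :
    ∫ ω, f ω ∂P ≤ ∫ ω, f ω * Real.exp (∑ k ∈ Finset.Ico m n,
      (c k * (Y k ω - μ k ω) - c k ^ 2 / 2 * (1 - s - μ k ω ^ 2))) ∂P := by
  induction n, hmn using Nat.le_induction with
  | base => simp
  | succ n hmn ih =>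
    have hS : Past Y n (fun ω => ∑ k ∈ Finset.Ico m n,
        (c k * (Y k ω - μ k ω) - c k ^ 2 / 2 * (1 - s - μ k ω ^ 2))) := by
      refine Past.sum fun k hk => ?_
      have hk := (Finset.mem_Ico.1 hk).2
      have h1 : Past Y n (fun ω => (Y k ω : ℝ)) := (Past.term hk).comp _
      exact h1.comp₂ ((h.past k).mono hk.le) fun y u =>
        c k * (y - u) - c k ^ 2 / 2 * (1 - s - u ^ 2)
    have hμ := h.past n
    have hg := ((hf.mono hmn).mul (hS.comp Real.exp)).mul
      (hμ.comp fun u => Real.exp (-(c n ^ 2 / 2 * (1 - s - u ^ 2))))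
    have hcn : Past Y n (fun _ : Ω => c n) := Past.const _
    refine (ih fun k hk => hc k (Finset.Ico_subset_Ico_right n.le_succ hk)).trans ?_
    simp_rw [Finset.sum_Ico_succ_top hmn]
    have : ∀ ω, f ω * Real.exp (∑ k ∈ Finset.Ico m n,
        (c k * (Y k ω - μ k ω) - c k ^ 2 / 2 * (1 - s - μ k ω ^ 2)) +
          (c n * (Y n ω - μ n ω) - c n ^ 2 / 2 * (1 - s - μ n ω ^ 2))) =
        f ω * Real.exp (∑ k ∈ Finset.Ico m n,
        (c k * (Y k ω - μ k ω) - c k ^ 2 / 2 * (1 - s - μ k ω ^ 2))) *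
        Real.exp (-(c n ^ 2 / 2 * (1 - s - μ n ω ^ 2))) *
          Real.exp (c n * (Y n ω - μ n ω)) := by
      intro ω
      rw [mul_assoc, mul_assoc, ← Real.exp_add, ← Real.exp_add]
      congr 2
      ring
    simp_rw [this]
    rw [h.integral_mul_exp (hm.trans hmn) hg hcn]
    refine integral_mono (h.integrable ((hf.mono hmn).mul (hS.comp Real.exp)))
      (h.integrable (hg.mul ?_)) fun ω => ?_
    · exact ((hcn.mul hμ).comp fun x => Real.exp (-x)).mul
        ((hcn.comp Real.cosh).add (hμ.mul (hcn.comp Real.sinh)))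
    · simp only
      rw [mul_assoc]
      refine le_mul_of_one_le_right (mul_nonneg (hf0 ω) (Real.exp_nonneg _)) ?_
      rw [Real.exp_neg, inv_mul_eq_div, one_le_div (Real.exp_pos _)]
      exact hθ₀ _ _ (hc n (Finset.mem_Ico.2 ⟨hmn, n.lt_succ_self⟩)) (h.abs_le n ω)

end IsSignSequence

namespace IsSignSequence

variable {Ω : Type*} [MeasurableSpace Ω] {P : Measure Ω} [IsProbabilityMeasure P] {k₀ : ℕ}
  {Y : ℕ → Ω → ℤ} {μ : ℕ → Ω → ℝ}

/-- Weighted version of the Azuma–Hoeffding inequality. -/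
lemma setIntegral_abs_ge_le (h : IsSignSequence P k₀ Y μ) {m n : ℕ} (hm : k₀ ≤ m) (hmn : m ≤ n)
    {f : Ω → ℝ} (hf : Past Y m f) (hf0 : ∀ ω, 0 ≤ f ω) {c : ℕ → Ω → ℝ}
    (hc : ∀ k, Past Y k (c k)) {b : ℕ → ℝ} (hb : ∀ k ω, |c k ω| ≤ b k) {V x : ℝ}
    (hV : 0 < V) (hbV : ∑ k ∈ Finset.Ico m n, b k ^ 2 ≤ V) (hx : 0 ≤ x) :
    ∫ ω in {ω | x ≤ |∑ k ∈ Finset.Ico m n, c k ω * (Y k ω - μ k ω)|}, f ω ∂P ≤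
      2 * Real.exp (-(x ^ 2 / (2 * V))) * ∫ ω, f ω ∂P := by
  set T : Ω → ℝ := fun ω => ∑ k ∈ Finset.Ico m n, c k ω * (Y k ω - μ k ω) with hT
  have hTp : Past Y n T := h.past_sum hc _ fun k hk => (Finset.mem_Ico.1 hk).2
  have hE : MeasurableSet {ω | x ≤ |T ω|} :=
    measurableSet_le measurable_const (hTp.measurable h.measurable).abs
  have hI : 0 ≤ ∫ ω, f ω ∂P := integral_nonneg hf0
  have hmgf : ∀ r : ℝ, ∫ ω, f ω * Real.exp (r * T ω) ∂P ≤
      Real.exp (r ^ 2 * V / 2) * ∫ ω, f ω ∂P := by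
    intro r
    have := h.integral_mul_exp_sum_le hm hmn hf hf0 (c := fun k ω => r * c k ω)
      (fun k => (hc k).comp (r * ·)) (b := fun k => |r| * b k)
      (fun k ω => by rw [abs_mul]; exact mul_le_mul_of_nonneg_left (hb k ω) (abs_nonneg r))
    simp only [hT, Finset.mul_sum, ← mul_assoc]
    refine this.trans (mul_le_mul_of_nonneg_right (Real.exp_le_exp.2 ?_) hI)
    simp_rw [mul_pow, ← Finset.mul_sum, sq_abs]
    gcongr
  have h_int : ∀ r : ℝ, Integrable (fun ω => f ω * Real.exp (r * T ω)) P := fun r =>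
    h.integrable ((hf.mono hmn).mul (hTp.comp fun t => Real.exp (r * t)))
  have hpt : ∀ ω, Set.indicator {ω | x ≤ |T ω|} f ω ≤ Real.exp (-(x ^ 2 / V)) *
      (f ω * Real.exp (x / V * T ω) + f ω * Real.exp (-(x / V) * T ω)) := by
    intro ω
    by_cases hω : x ≤ |T ω|
    · rw [Set.indicator_of_mem (by exact hω), ← mul_add, mul_left_comm]
      refine le_mul_of_one_le_right (hf0 ω) ?_
      rw [mul_add, ← Real.exp_add, ← Real.exp_add]
      have hr : 0 ≤ x / V := by positivity
      rcases le_abs'.1 hω with hneg | hpos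
      · have : 1 ≤ Real.exp (-(x ^ 2 / V) + -(x / V) * T ω) :=
          Real.one_le_exp (by
            have e : x / V * x = x ^ 2 / V := by ring
            nlinarith [mul_le_mul_of_nonneg_left hneg hr])
        linarith [Real.exp_pos (-(x ^ 2 / V) + (x / V) * T ω)]
      · have : 1 ≤ Real.exp (-(x ^ 2 / V) + (x / V) * T ω) :=
          Real.one_le_exp (by
            have e : x / V * x = x ^ 2 / V := by ring
            nlinarith [mul_le_mul_of_nonneg_left hpos hr])
        linarith [Real.exp_pos (-(x ^ 2 / V) + -(x / V) * T ω)]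
    · rw [Set.indicator_of_notMem (by exact hω)]
      have := hf0 ω
      positivity
  calc ∫ ω in {ω | x ≤ |T ω|}, f ω ∂P = ∫ ω, Set.indicator {ω | x ≤ |T ω|} f ω ∂P :=
        (integral_indicator hE).symm
    _ ≤ ∫ ω, Real.exp (-(x ^ 2 / V)) *
      (f ω * Real.exp (x / V * T ω) + f ω * Real.exp (-(x / V) * T ω)) ∂P :=
        integral_mono ((h.integrable hf).indicator hE) (((h_int _).add (h_int _)).const_mul _) hpt
    _ ≤ Real.exp (-(x ^ 2 / V)) * (Real.exp ((x / V) ^ 2 * V / 2) * ∫ ω, f ω ∂P +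
          Real.exp ((-(x / V)) ^ 2 * V / 2) * ∫ ω, f ω ∂P) := by
        rw [integral_const_mul, integral_add (h_int _) (h_int _)]
        gcongr <;> exact hmgf _
    _ = 2 * Real.exp (-(x ^ 2 / (2 * V))) * ∫ ω, f ω ∂P := by
        have : Real.exp (-(x ^ 2 / (2 * V))) =
            Real.exp (-(x ^ 2 / V)) * Real.exp ((x / V) ^ 2 * V / 2) := by
          rw [← Real.exp_add]
          congr 1
          field_simp
          ring
        rw [this, neg_sq]
        ring

lemma measure_abs_ge_le (h : IsSignSequence P k₀ Y μ) {m n : ℕ} (hm : k₀ ≤ m) (hmn : m ≤ n)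
    {c : ℕ → Ω → ℝ} (hc : ∀ k, Past Y k (c k)) {b : ℕ → ℝ} (hb : ∀ k ω, |c k ω| ≤ b k) {V x : ℝ}
    (hV : 0 < V) (hbV : ∑ k ∈ Finset.Ico m n, b k ^ 2 ≤ V) (hx : 0 ≤ x) :
    P.real {ω | x ≤ |∑ k ∈ Finset.Ico m n, c k ω * (Y k ω - μ k ω)|} ≤
      2 * Real.exp (-(x ^ 2 / (2 * V))) := by
  simpa using h.setIntegral_abs_ge_le hm hmn (f := fun _ => 1) (Past.const 1)
    (fun _ => zero_le_one) hc hb hV hbV hx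

/-- Maximal version of the Azuma–Hoeffding inequality. -/
lemma measure_exists_abs_ge_le (h : IsSignSequence P k₀ Y μ) {m n : ℕ} (hm : k₀ ≤ m) (hmn : m ≤ n)
    (c : ℕ → ℝ) {V x : ℝ} (hV : 0 < V) (hbV : ∑ k ∈ Finset.Ico m n, c k ^ 2 ≤ V) (hx : 0 ≤ x) :
    P.real {ω | ∃ j ≤ n, x ≤ |∑ k ∈ Finset.Ico m j, c k * (Y k ω - μ k ω)|} ≤
      2 * Real.exp (-(x ^ 2 / (2 * V))) := by
  classical
  set T : ℕ → Ω → ℝ := fun j ω => ∑ k ∈ Finset.Ico m j, c k * (Y k ω - μ k ω) with hT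
  let c' : ℕ → Ω → ℝ := fun k ω => if ∀ j ≤ k, |T j ω| < x then c k else 0
  have hTp : ∀ k, ∀ j ≤ k, Past Y k (T j) := fun k j hj =>
    h.past_sum (c := fun k _ => c k) (fun k => Past.const _) _
      fun i hi => (Finset.mem_Ico.1 hi).2.trans_le hj
  have hc' : ∀ k, Past Y k (c' k) := by
    intro k ω ω' hω
    have : (∀ j ≤ k, |T j ω| < x) ↔ ∀ j ≤ k, |T j ω'| < x :=
      forall₂_congr fun j hj => by rw [hTp k j hj ω ω' hω]
    simp only [c', this]
  have hb : ∀ k ω, |c' k ω| ≤ |c k| := by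
    intro k ω
    simp only [c']
    split_ifs
    · exact le_rfl
    · simp
  refine le_trans (measureReal_mono ?_) (h.measure_abs_ge_le hm hmn hc' hb hV
    (by simpa only [sq_abs] using hbV) hx)
  rintro ω ⟨j, hjn, hj⟩
  have hex : ∃ j, x ≤ |T j ω| := ⟨j, hj⟩
  set j₀ := Nat.find hex with hj₀
  have hj₀x : x ≤ |T j₀ ω| := Nat.find_spec hex
  have hj₀n : j₀ ≤ n := (Nat.find_min' hex hj).trans hjn
  have hterm : ∀ k, c' k ω = if k < j₀ then c k else 0 := by
    intro k
    simp only [c']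
    refine if_congr ⟨fun hk => ?_, fun hk j hjk => ?_⟩ rfl rfl
    · by_contra hlt
      exact (hk j₀ (not_lt.1 hlt)).not_ge hj₀x
    · exact not_le.1 (Nat.find_min hex (hjk.trans_lt hk))
  have hsum : ∑ k ∈ Finset.Ico m n, c' k ω * (Y k ω - μ k ω) = T j₀ ω := by
    simp only [hterm, hT, ite_mul, zero_mul]
    rw [← Finset.sum_filter]
    refine Finset.sum_congr ?_ fun _ _ => rfl
    ext k
    simp only [Finset.mem_filter, Finset.mem_Ico]
    omega
  simpa only [Set.mem_ofPred_eq, hsum] using hj₀x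

end IsSignSequence

/-- A conditional second Borel–Cantelli lemma: if, given the past and on `G k`, the event `E k` has
conditional probability at least `r k` with `∑ r k = ∞`, then almost surely `E k` occurs infinitely
often as soon as `G k` occurs eventually. -/
lemma ae_frequently_of_past {Ω : Type*} [MeasurableSpace Ω] {P : Measure Ω}
    [IsProbabilityMeasure P] {Y : ℕ → Ω → ℤ} (hY : ∀ n, Measurable (Y n)) {ν : ℕ → ℕ}
    (hν : Monotone ν) {E G : ℕ → Set Ω} (hE : ∀ k, Past Y (ν (k + 1)) (· ∈ E k))
    (hG : ∀ k, Past Y (ν k) (· ∈ G k)) {r : ℕ → ℝ} {k₁ : ℕ}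
    (hr : ∀ k ≥ k₁, ∀ C : Set Ω, Past Y (ν k) (· ∈ C) → C ⊆ G k →
      r k * P.real C ≤ P.real (C ∩ E k))
    (hsum : Tendsto (fun n => ∑ k ∈ Finset.range n, r k) atTop atTop) :
    ∀ᵐ ω ∂P, (∀ᶠ k in atTop, ω ∈ G k) → ∃ᶠ k in atTop, ω ∈ E k := by
  have key : ∀ K ≥ k₁, ∀ᵐ ω ∂P, ¬ ∀ k ≥ K, ω ∈ G k ∧ ω ∉ E k := by
    intro K hK
    let C : ℕ → Set Ω := fun L => {ω | ∀ k, K ≤ k → k < L → ω ∈ G k ∧ ω ∉ E k}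
    have hC : ∀ L, Past Y (ν L) (· ∈ C L) := by
      intro L ω ω' h
      refine propext (forall₃_congr fun k _ hkL => ?_)
      have h1 := hG k ω ω' fun i hi => h i (hi.trans_le (hν hkL.le))
      have h2 := hE k ω ω' fun i hi => h i (hi.trans_le (hν hkL))
      simp only at h1 h2
      rw [h1, h2]
    have hmeas : ∀ k, MeasurableSet (E k) := fun k =>
      measurableSet_setOfPred.2 ((hE k).measurable hY)
    have hbound : ∀ L ≥ K, P.real (C L) ≤ Real.exp (-∑ k ∈ Finset.Ico K L, r k) := by
      intro L hL
      induction L, hL using Nat.le_induction with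
      | base => simp
      | succ L hL ih =>
        have hpast : Past Y (ν L) (· ∈ C L ∩ G L) := (hC L).comp₂ (hG L) And
        have h1 := hr L (hK.trans hL) (C L ∩ G L) hpast Set.inter_subset_right
        have h2 : P.real (C (L + 1)) ≤ P.real (C L ∩ G L) - P.real (C L ∩ G L ∩ E L) := by
          rw [← measureReal_inter_add_sdiff (s := C L ∩ G L) (hmeas L), add_sub_cancel_left]
          refine measureReal_mono fun ω hω => ?_
          exact ⟨⟨fun k hk hkL => hω k hk (hkL.trans L.lt_succ_self), (hω L hL L.lt_succ_self).1⟩,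
            (hω L hL L.lt_succ_self).2⟩
        have h3 : P.real (C L ∩ G L) ≤ P.real (C L) := measureReal_mono Set.inter_subset_left
        have h4 := Real.add_one_le_exp (-r L)
        rw [Finset.sum_Ico_succ_top hL, neg_add, Real.exp_add]
        have h5 : P.real (C (L + 1)) ≤ (-r L + 1) * P.real (C L ∩ G L) := by linarith
        calc _ ≤ Real.exp (-r L) * P.real (C L ∩ G L) :=
              h5.trans (mul_le_mul_of_nonneg_right h4 measureReal_nonneg)
          _ ≤ Real.exp (-r L) * Real.exp (-∑ k ∈ Finset.Ico K L, r k) := by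
              gcongr
              exact h3.trans ih
          _ = _ := mul_comm _ _
    have hlim : Tendsto (fun L => Real.exp (-∑ k ∈ Finset.Ico K L, r k)) atTop (nhds 0) := by
      refine Real.tendsto_exp_neg_atTop_nhds_zero.comp ?_
      refine (tendsto_atTop_add_const_right _ (-∑ k ∈ Finset.range K, r k) hsum).congr' ?_
      filter_upwards [eventually_ge_atTop K] with L hL
      rw [Finset.sum_Ico_eq_sub _ hL, sub_eq_add_neg]
    have hzero : P.real {ω | ∀ k ≥ K, ω ∈ G k ∧ ω ∉ E k} ≤ 0 := by
      refine ge_of_tendsto hlim ?_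
      filter_upwards [eventually_ge_atTop K] with L hL
      have hsub : {ω | ∀ k ≥ K, ω ∈ G k ∧ ω ∉ E k} ⊆ C L := fun ω hω k hk _ => hω k hk
      exact (measureReal_mono hsub).trans (hbound L hL)
    have := le_antisymm hzero measureReal_nonneg
    rw [measureReal_eq_zero_iff] at this
    rw [ae_iff]
    simpa using this
  have key' : ∀ᵐ ω ∂P, ∀ K ≥ k₁, ¬ ∀ k ≥ K, ω ∈ G k ∧ ω ∉ E k :=
    ae_all_iff.2 fun K => ae_all_iff.2 fun hK => key K hK
  filter_upwards [key'] with ω hω hGω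
  by_contra hE'
  obtain ⟨K, hK⟩ := eventually_atTop.1 (hGω.and (not_frequently.1 hE'))
  exact hω (max K k₁) (le_max_right _ _) fun k hk => hK k ((le_max_left _ _).trans hk)

namespace IsSignSequence

variable {Ω : Type*} [MeasurableSpace Ω] {P : Measure Ω} [IsProbabilityMeasure P] {k₀ : ℕ}
  {Y : ℕ → Ω → ℤ} {μ : ℕ → Ω → ℝ}

/-- Kolmogorov's lower exponential bound, weighted by a function of the past. -/
lemma le_setIntegral_ge (h : IsSignSequence P k₀ Y μ) {m n : ℕ} (hm : k₀ ≤ m) (hmn : m ≤ n)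
    {f : Ω → ℝ} (hf : Past Y m f) (hf0 : ∀ ω, 0 ≤ f ω) {c : ℕ → ℝ} {γ θ₀ r V W : ℝ}
    (hγ0 : 0 < γ) (hγ1 : γ ≤ 1)
    (hθ₀ : ∀ θ u : ℝ, |θ| ≤ θ₀ → |u| ≤ 1 → Real.exp (θ ^ 2 / 2 * (1 - γ ^ 2 / 4 - u ^ 2)) ≤
        Real.exp (-(θ * u)) * (Real.cosh θ + u * Real.sinh θ))
    (hr : 0 ≤ r) (hc : ∀ k ∈ Finset.Ico m n, |r * c k| ≤ θ₀)
    (hV : ∑ k ∈ Finset.Ico m n, c k ^ 2 = V) (hW : r ^ 2 * V = W)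
    (hWγ : 3 ≤ Real.exp (γ ^ 2 * W / 4) / 2)
    (hR : ∫ ω in {ω | γ ^ 2 / 4 * V < ∑ k ∈ Finset.Ico m n, c k ^ 2 * μ k ω ^ 2}, f ω ∂P ≤
      Real.exp (-(4 * W)) * ∫ ω, f ω ∂P) :
    Real.exp (-(W * (1 / 2 + γ + γ ^ 2 / 4))) / 2 * ∫ ω, f ω ∂P ≤
      ∫ ω in {ω | (1 - γ) * (r * V) ≤ ∑ k ∈ Finset.Ico m n, c k * (Y k ω - μ k ω)}, f ω ∂P := by
  set T : Ω → ℝ := fun ω => ∑ k ∈ Finset.Ico m n, c k * (Y k ω - μ k ω) with hT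
  set R : Ω → ℝ := fun ω => ∑ k ∈ Finset.Ico m n, c k ^ 2 * μ k ω ^ 2 with hRdef
  have hTp : Past Y n T :=
    h.past_sum (c := fun k _ => c k) (fun k => Past.const _) _ fun k hk => (Finset.mem_Ico.1 hk).2
  have hRp : Past Y n R := Past.sum fun k hk =>
    ((h.past k).mono (Finset.mem_Ico.1 hk).2.le).comp fun u => c k ^ 2 * u ^ 2
  have hV0 : 0 ≤ V := hV ▸ Finset.sum_nonneg fun k _ => sq_nonneg _
  have hW0 : 0 ≤ W := hW ▸ by positivity
  have hfn := hf.mono hmn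
  have hRV : ∀ ω, R ω ≤ V := by
    intro ω
    rw [← hV]
    refine Finset.sum_le_sum fun k _ => mul_le_of_le_one_right (sq_nonneg _) ?_
    rw [← sq_abs]
    exact pow_le_one₀ (abs_nonneg _) (h.abs_le k ω)
  have hI : 0 ≤ ∫ ω, f ω ∂P := integral_nonneg hf0
  have hmgf : ∀ t : ℝ, ∫ ω, f ω * Real.exp (t * r * T ω) ∂P ≤
      Real.exp (t ^ 2 * W / 2) * ∫ ω, f ω ∂P := by
    intro t
    have := h.integral_mul_exp_sum_le hm hmn hf hf0 (c := fun k _ => t * r * c k)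
      (fun k => Past.const _) (b := fun k => |t * r * c k|) (fun k ω => le_rfl)
    simp only [hT, Finset.mul_sum, ← mul_assoc]
    refine this.trans (le_of_eq ?_)
    simp_rw [sq_abs, mul_pow, ← Finset.mul_sum, hV]
    rw [← hW, mul_assoc]
  have h_int : ∀ t : ℝ, Integrable (fun ω => f ω * Real.exp (t * r * T ω)) P := fun t =>
    h.integrable (hfn.mul (hTp.comp fun x => Real.exp (t * r * x)))
  have hBm : MeasurableSet {ω | γ ^ 2 / 4 * V < R ω} :=
    measurableSet_lt measurable_const (hRp.measurable h.measurable)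
  have hEm : MeasurableSet {ω | (1 - γ) * (r * V) ≤ T ω} :=
    measurableSet_le measurable_const (hTp.measurable h.measurable)
  have hfi := h.integrable hf
  -- lower bound for the exponential moment
  have hlow : Real.exp ((1 - γ ^ 2 / 4) * W / 2) * ∫ ω, f ω ∂P ≤
      ∫ ω, f ω * Real.exp (r * T ω + r ^ 2 / 2 * R ω) ∂P := by
    have := h.le_integral_mul_exp_sum hm hmn hf hf0 hθ₀ hc
    rw [← le_div_iff₀' (Real.exp_pos _), div_eq_inv_mul, ← integral_const_mul]
    refine this.trans (le_of_eq (integral_congr_ae (ae_of_all _ fun ω => ?_)))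
    simp only
    rw [mul_left_comm, ← Real.exp_neg, ← Real.exp_add]
    congr 2
    rw [Finset.sum_sub_distrib, ← hW, ← hV]
    simp only [hT, hRdef, Finset.mul_sum, Finset.sum_div]
    rw [← Finset.sum_neg_distrib, ← Finset.sum_add_distrib, ← Finset.sum_sub_distrib,
      ← Finset.sum_add_distrib]
    refine Finset.sum_congr rfl fun k _ => ?_
    ring
  have hup : ∀ ω, f ω * Real.exp (r * T ω + r ^ 2 / 2 * R ω) ≤
      Real.exp (γ ^ 2 / 4 * W / 2) * (f ω * Real.exp (1 * r * T ω)) +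
        Real.exp (W / 2) * (Real.exp (-(3 * W)) / 2 * (f ω * Real.exp (2 * r * T ω)) +
          Real.exp (3 * W) / 2 * Set.indicator {ω | γ ^ 2 / 4 * V < R ω} f ω) := by
    intro ω
    have hfω := hf0 ω
    by_cases hω : γ ^ 2 / 4 * V < R ω
    · rw [Set.indicator_of_mem (by exact hω)]
      have h1 : Real.exp (r * T ω + r ^ 2 / 2 * R ω) ≤
          Real.exp (W / 2) * Real.exp (r * T ω) := by
        rw [← Real.exp_add]
        refine Real.exp_le_exp.2 ?_
        rw [← hW]
        nlinarith [mul_le_mul_of_nonneg_left (hRV ω) (sq_nonneg r)]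
      have h2 : Real.exp (r * T ω) ≤ Real.exp (-(3 * W)) / 2 * Real.exp (2 * r * T ω) +
          Real.exp (3 * W) / 2 := by
        have e1 : Real.exp (2 * r * T ω) = Real.exp (r * T ω) ^ 2 := by
          rw [← Real.exp_nat_mul]; congr 1; push_cast; ring
        have e2 : Real.exp (-(3 * W)) * Real.exp (3 * W) = 1 := by
          rw [← Real.exp_add]; simp
        have e3 := Real.exp_pos (-(3 * W))
        have e4 := mul_nonneg e3.le (sq_nonneg (Real.exp (r * T ω) - Real.exp (3 * W)))
        have e5 : Real.exp (-(3 * W)) * (Real.exp (r * T ω) - Real.exp (3 * W)) ^ 2 =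
            Real.exp (-(3 * W)) * Real.exp (r * T ω) ^ 2 - 2 * Real.exp (r * T ω) +
              Real.exp (3 * W) := by
          linear_combination (Real.exp (3 * W) - 2 * Real.exp (r * T ω)) * e2
        rw [e1]
        linarith
      calc _ ≤ f ω * (Real.exp (W / 2) * (Real.exp (-(3 * W)) / 2 * Real.exp (2 * r * T ω) +
          Real.exp (3 * W) / 2)) := by gcongr; exact h1.trans (by gcongr)
        _ = Real.exp (W / 2) * (Real.exp (-(3 * W)) / 2 * (f ω * Real.exp (2 * r * T ω)) +
          Real.exp (3 * W) / 2 * f ω) := by ring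
        _ ≤ _ := le_add_of_nonneg_left (by positivity)
    · rw [Set.indicator_of_notMem (by exact hω)]
      have h1 : Real.exp (r * T ω + r ^ 2 / 2 * R ω) ≤
          Real.exp (γ ^ 2 / 4 * W / 2) * Real.exp (1 * r * T ω) := by
        rw [← Real.exp_add]
        refine Real.exp_le_exp.2 ?_
        rw [← hW]
        nlinarith [mul_le_mul_of_nonneg_left (not_lt.1 hω) (sq_nonneg r)]
      calc _ ≤ f ω * (Real.exp (γ ^ 2 / 4 * W / 2) * Real.exp (1 * r * T ω)) := by gcongr
        _ = Real.exp (γ ^ 2 / 4 * W / 2) * (f ω * Real.exp (1 * r * T ω)) := by ring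
        _ ≤ _ := le_add_of_nonneg_right (by positivity)
  have hlow' : Real.exp ((1 - γ ^ 2 / 4) * W / 2) * ∫ ω, f ω ∂P ≤
      Real.exp (γ ^ 2 / 4 * W / 2) * (∫ ω, f ω * Real.exp (1 * r * T ω) ∂P) + ∫ ω, f ω ∂P := by
    have hRi : Integrable (fun ω => f ω * Real.exp (r * T ω + r ^ 2 / 2 * R ω)) P :=
      h.integrable (hfn.mul (hTp.comp₂ hRp fun x y => Real.exp (r * x + r ^ 2 / 2 * y)))
    have i1 := (h_int 1).const_mul (Real.exp (γ ^ 2 / 4 * W / 2))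
    have i2 := (h_int 2).const_mul (Real.exp (-(3 * W)) / 2)
    have i3 := (hfi.indicator hBm).const_mul (Real.exp (3 * W) / 2)
    have := hlow.trans (integral_mono hRi
      (i1.fun_add ((i2.fun_add i3).const_mul (Real.exp (W / 2)))) hup)
    refine this.trans ?_
    rw [integral_add i1 ((i2.fun_add i3).const_mul _), integral_const_mul, integral_const_mul,
      integral_add i2 i3, integral_const_mul, integral_const_mul, integral_indicator hBm]
    gcongr
    have e2 := hmgf 2
    calc _ ≤ Real.exp (W / 2) * (Real.exp (-(3 * W)) / 2 *
          (Real.exp (2 ^ 2 * W / 2) * ∫ ω, f ω ∂P) +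
          Real.exp (3 * W) / 2 * (Real.exp (-(4 * W)) * ∫ ω, f ω ∂P)) := by gcongr
      _ = Real.exp (-(W / 2)) * ∫ ω, f ω ∂P := by
        have x1 : Real.exp (-(W / 2)) =
            Real.exp (W / 2) * (Real.exp (-(3 * W)) * Real.exp (2 ^ 2 * W / 2)) := by
          rw [← Real.exp_add, ← Real.exp_add]; congr 1; ring
        have x2 : Real.exp (-(W / 2)) =
            Real.exp (W / 2) * (Real.exp (3 * W) * Real.exp (-(4 * W))) := by
          rw [← Real.exp_add, ← Real.exp_add]; congr 1; ring
        linear_combination (-(∫ ω, f ω ∂P) / 2) * x1 + (-(∫ ω, f ω ∂P) / 2) * x2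
      _ ≤ _ := mul_le_of_le_one_left hI (Real.exp_le_one_iff.2 (by linarith))
  -- the exponential moment comes from the event that `T` is close to `r * V`
  have hpt : ∀ ω, f ω * Real.exp (1 * r * T ω) ≤
      Real.exp (γ * (1 - γ) * W) * (f ω * Real.exp ((1 - γ) * r * T ω)) +
      Real.exp (-(γ * (1 + γ) * W)) * (f ω * Real.exp ((1 + γ) * r * T ω)) +
      Real.exp ((1 + γ) * W) * Set.indicator {ω | (1 - γ) * (r * V) ≤ T ω} f ω := by
    intro ω
    have hfω := hf0 ω
    have hind : 0 ≤ Set.indicator {ω | (1 - γ) * (r * V) ≤ T ω} f ω :=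
      Set.indicator_nonneg (fun ω _ => hf0 ω) ω
    have hrV : r * (r * V) = W := by rw [← hW]; ring
    by_cases h1 : (1 - γ) * (r * V) ≤ T ω
    · by_cases h2 : T ω ≤ (1 + γ) * (r * V)
      · rw [Set.indicator_of_mem (by exact h1)]
        have : Real.exp (1 * r * T ω) ≤ Real.exp ((1 + γ) * W) := by
          refine Real.exp_le_exp.2 ?_
          nlinarith [mul_le_mul_of_nonneg_left h2 hr]
        calc _ ≤ f ω * Real.exp ((1 + γ) * W) := by gcongr
          _ = Real.exp ((1 + γ) * W) * f ω := mul_comm _ _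
          _ ≤ _ := le_add_of_nonneg_left (by positivity)
      · have : Real.exp (1 * r * T ω) ≤
            Real.exp (-(γ * (1 + γ) * W)) * Real.exp ((1 + γ) * r * T ω) := by
          rw [← Real.exp_add]
          refine Real.exp_le_exp.2 ?_
          nlinarith [mul_le_mul_of_nonneg_left (not_le.1 h2).le (mul_nonneg hγ0.le hr)]
        calc _ ≤ f ω * (Real.exp (-(γ * (1 + γ) * W)) * Real.exp ((1 + γ) * r * T ω)) := by gcongr
          _ = Real.exp (-(γ * (1 + γ) * W)) * (f ω * Real.exp ((1 + γ) * r * T ω)) := by ring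
          _ ≤ _ := by
            have := Real.exp_pos ((1 + γ) * W)
            have : 0 ≤ Real.exp (γ * (1 - γ) * W) * (f ω * Real.exp ((1 - γ) * r * T ω)) := by
              positivity
            nlinarith
    · have : Real.exp (1 * r * T ω) ≤
          Real.exp (γ * (1 - γ) * W) * Real.exp ((1 - γ) * r * T ω) := by
        rw [← Real.exp_add]
        refine Real.exp_le_exp.2 ?_
        nlinarith [mul_le_mul_of_nonneg_left (not_le.1 h1).le (mul_nonneg hγ0.le hr)]
      calc _ ≤ f ω * (Real.exp (γ * (1 - γ) * W) * Real.exp ((1 - γ) * r * T ω)) := by gcongr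
        _ = Real.exp (γ * (1 - γ) * W) * (f ω * Real.exp ((1 - γ) * r * T ω)) := by ring
        _ ≤ _ := by
          rw [add_assoc]
          exact le_add_of_nonneg_right (by positivity)
  have htilt : ∫ ω, f ω * Real.exp (1 * r * T ω) ∂P ≤
      2 * Real.exp ((1 - γ ^ 2) * W / 2) * (∫ ω, f ω ∂P) +
        Real.exp ((1 + γ) * W) * ∫ ω in {ω | (1 - γ) * (r * V) ≤ T ω}, f ω ∂P := by
    have i1 := (h_int (1 - γ)).const_mul (Real.exp (γ * (1 - γ) * W))
    have i2 := (h_int (1 + γ)).const_mul (Real.exp (-(γ * (1 + γ) * W)))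
    have i3 := (hfi.indicator hEm).const_mul (Real.exp ((1 + γ) * W))
    refine (integral_mono (h_int 1) ((i1.fun_add i2).fun_add i3) hpt).trans ?_
    rw [integral_add (i1.fun_add i2) i3, integral_add i1 i2, integral_const_mul, integral_const_mul,
      integral_const_mul, integral_indicator hEm]
    gcongr
    have x1 : Real.exp ((1 - γ ^ 2) * W / 2) =
        Real.exp (γ * (1 - γ) * W) * Real.exp ((1 - γ) ^ 2 * W / 2) := by
      rw [← Real.exp_add]; congr 1; ring
    have x2 : Real.exp ((1 - γ ^ 2) * W / 2) =
        Real.exp (-(γ * (1 + γ) * W)) * Real.exp ((1 + γ) ^ 2 * W / 2) := by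
      rw [← Real.exp_add]; congr 1; ring
    refine (add_le_add (mul_le_mul_of_nonneg_left (hmgf (1 - γ)) (Real.exp_nonneg _))
      (mul_le_mul_of_nonneg_left (hmgf (1 + γ)) (Real.exp_nonneg _))).trans (le_of_eq ?_)
    linear_combination (-∫ ω, f ω ∂P) * x1 + (-∫ ω, f ω ∂P) * x2
  set J := ∫ ω in {ω | (1 - γ) * (r * V) ≤ T ω}, f ω ∂P
  set I := ∫ ω, f ω ∂P
  set a := Real.exp ((1 - γ ^ 2) * W / 2) with ha
  have ha1 : 1 ≤ Real.exp (γ ^ 2 / 4 * W / 2) * a := by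
    rw [ha, ← Real.exp_add]
    refine Real.one_le_exp ?_
    nlinarith [mul_nonneg hW0 (by nlinarith : 0 ≤ 1 - γ ^ 2), mul_nonneg hW0 (sq_nonneg γ)]
  have hmain : Real.exp ((1 - γ ^ 2 / 4) * W / 2) * I ≤
      Real.exp (γ ^ 2 / 4 * W / 2) * (3 * a * I + Real.exp ((1 + γ) * W) * J) := by
    refine hlow'.trans ?_
    have := mul_le_mul_of_nonneg_left htilt (Real.exp_nonneg (γ ^ 2 / 4 * W / 2))
    nlinarith [mul_le_mul_of_nonneg_right ha1 hI]
  have h_moment_le : Real.exp ((1 - γ ^ 2 / 2) * W / 2) * I ≤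
      3 * a * I + Real.exp ((1 + γ) * W) * J := by
    have x1 : Real.exp ((1 - γ ^ 2 / 4) * W / 2) =
        Real.exp (γ ^ 2 / 4 * W / 2) * Real.exp ((1 - γ ^ 2 / 2) * W / 2) := by
      rw [← Real.exp_add]; congr 1; ring
    rw [x1, mul_assoc] at hmain
    exact le_of_mul_le_mul_left hmain (Real.exp_pos _)
  have x2 : Real.exp ((1 - γ ^ 2 / 2) * W / 2) = Real.exp (γ ^ 2 * W / 4) * a := by
    rw [ha, ← Real.exp_add]; congr 1; ring
  have h_half_le : Real.exp ((1 - γ ^ 2 / 2) * W / 2) / 2 * I ≤ Real.exp ((1 + γ) * W) * J := by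
    have : 3 * a * I ≤ Real.exp ((1 - γ ^ 2 / 2) * W / 2) / 2 * I := by
      rw [x2]
      have := mul_le_mul_of_nonneg_right hWγ (mul_nonneg (Real.exp_nonneg _) hI : 0 ≤ a * I)
      linarith
    linarith
  have x3 : Real.exp (-(W * (1 / 2 + γ + γ ^ 2 / 4))) =
      Real.exp (-((1 + γ) * W)) * Real.exp ((1 - γ ^ 2 / 2) * W / 2) := by
    rw [← Real.exp_add]; congr 1; ring
  rw [x3, Real.exp_neg, mul_div_assoc, mul_assoc, inv_mul_le_iff₀ (Real.exp_pos _)]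
  exact h_half_le

end IsSignSequence

/-- The growth factor `∏_{0 < j < n} (1 + a / j)` of a solution of `s (j + 1) = (1 + a / j) s j`. -/
def growth (a : ℝ) (n : ℕ) : ℝ := ∏ j ∈ Finset.range n, (1 + a / j)

lemma growth_one (a : ℝ) : growth a 1 = 1 := by simp [growth]

lemma growth_succ (a : ℝ) (n : ℕ) : growth a (n + 1) = growth a n * (1 + a / n) :=
  Finset.prod_range_succ _ _

lemma one_add_div_pos {a : ℝ} (ha : -1 < a) (n : ℕ) : 0 < 1 + a / n := by
  rcases Nat.eq_zero_or_pos n with rfl | hn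
  · simp
  · have hn' : (1 : ℝ) ≤ n := by exact_mod_cast hn
    have : 0 < (n : ℝ) := by linarith
    rw [show 1 + a / n = (n + a) / n by field_simp]
    exact div_pos (by linarith) this

lemma growth_pos {a : ℝ} (ha : -1 < a) (n : ℕ) : 0 < growth a n :=
  Finset.prod_pos fun j _ => one_add_div_pos ha j

lemma growth_div_eq_prod {a : ℝ} (ha : -1 < a) {m n : ℕ} (hmn : m ≤ n) :
    growth a n / growth a m = ∏ j ∈ Finset.Ico m n, (1 + a / j) := by
  rw [div_eq_iff (growth_pos ha m).ne', mul_comm, growth, growth,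
    Finset.prod_range_mul_prod_Ico _ hmn]

lemma sum_inv_le_log {m n : ℕ} (hm : 1 ≤ m) (hmn : m ≤ n) :
    ∑ j ∈ Finset.Ico m n, 1 / (j : ℝ) ≤ 1 + Real.log (n / m) := by
  have hm0 : (1 : ℝ) ≤ m := by exact_mod_cast hm
  have key : ∑ j ∈ Finset.Ico m n, 1 / (j : ℝ) ≤ Real.log (n / m) + 1 / m - 1 / n := by
    induction n, hmn using Nat.le_induction with
    | base => simp [div_self (by positivity : (m : ℝ) ≠ 0)]
    | succ n hmn ih =>
      have hn0 : (1 : ℝ) ≤ n := by exact_mod_cast hm.trans hmn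
      have hn : (0 : ℝ) < n := by linarith
      rw [Finset.sum_Ico_succ_top hmn]
      have h1 := Real.one_sub_inv_le_log_of_pos (show (0 : ℝ) < (n + 1) / n by positivity)
      have h2 : Real.log (((n + 1 : ℕ) : ℝ) / m) = Real.log (n / m) + Real.log ((n + 1) / n) := by
        rw [← Real.log_mul (by positivity) (by positivity)]
        congr 1
        push_cast
        field_simp
      have h3 : 1 - ((n + 1 : ℝ) / n)⁻¹ = 1 / (n + 1) := by field_simp; ring
      rw [h2]
      push_cast
      rw [h3] at h1
      linarith
  have h1 : 1 / (m : ℝ) ≤ 1 := by rw [div_le_one (by linarith)]; exact hm0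
  have h2 : 0 ≤ 1 / (n : ℝ) := by positivity
  linarith

lemma growth_div_le {a b : ℝ} (ha : -1 < a) (hab : a ≤ b) (hb0 : 0 ≤ b) (hb1 : b ≤ 1) {m n : ℕ}
    (hm : 1 ≤ m) (hmn : m ≤ n) : growth a n / growth a m ≤ Real.exp 1 * ((n : ℝ) / m) ^ b := by
  have hm0 : (0 : ℝ) < m := by exact_mod_cast hm
  have hn0 : (0 : ℝ) < n := by exact_mod_cast hm.trans hmn
  rw [growth_div_eq_prod ha hmn]
  calc ∏ j ∈ Finset.Ico m n, (1 + a / j) ≤ ∏ j ∈ Finset.Ico m n, Real.exp (b * (1 / (j : ℝ))) := by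
        refine Finset.prod_le_prod (fun j _ => (one_add_div_pos ha j).le) fun j _ => ?_
        have h1 := Real.add_one_le_exp (b * (1 / (j : ℝ)))
        have h2 : a / j ≤ b * (1 / (j : ℝ)) := by rw [mul_one_div]; gcongr
        linarith
    _ = Real.exp (b * ∑ j ∈ Finset.Ico m n, 1 / (j : ℝ)) := by
        rw [← Real.exp_sum, Finset.mul_sum]
    _ ≤ Real.exp (b * (1 + Real.log (n / m))) := by
        gcongr
        exact sum_inv_le_log hm hmn
    _ ≤ _ := by
        rw [mul_add, mul_one, Real.exp_add, Real.rpow_def_of_pos (by positivity),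
          mul_comm (Real.log _)]
        gcongr

lemma abs_growth_div_sub_one_le {a η : ℝ} (ha : -1 < a) (ha1 : a ≤ 1) {m n : ℕ} (hm : 1 ≤ m)
    (hmn : m ≤ n) (hη : (n : ℝ) ≤ (1 + η) * m) :
    |growth a n / growth a m - 1| ≤ Real.exp η - 1 := by
  have hm0 : (0 : ℝ) < m := by exact_mod_cast hm
  rw [growth_div_eq_prod ha hmn, ← Real.norm_eq_abs]
  refine (Finset.norm_prod_one_add_sub_one_le _ _).trans ?_
  gcongr
  calc ∑ j ∈ Finset.Ico m n, ‖a / (j : ℝ)‖ ≤ ∑ j ∈ Finset.Ico m n, 1 / (m : ℝ) := by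
        refine Finset.sum_le_sum fun j hj => ?_
        have : (m : ℝ) ≤ j := by exact_mod_cast (Finset.mem_Ico.1 hj).1
        rw [norm_div, Real.norm_natCast, Real.norm_eq_abs]
        gcongr
        exact abs_le.2 ⟨ha.le, ha1⟩
    _ = (n - m) / m := by
        rw [Finset.sum_const, Nat.card_Ico, nsmul_eq_mul, Nat.cast_sub hmn]; ring
    _ ≤ η := by rw [div_le_iff₀ hm0]; linarith

/-- Solution of the linear recursion `s (j + 1) = (1 + a / j) s j + ξ j`. -/
lemma eq_growth_mul_add_sum {a : ℝ} (ha : -1 < a) {s ξ : ℕ → ℝ} {m n : ℕ} (hmn : m ≤ n)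
    (hs : ∀ j ≥ m, s (j + 1) = (1 + a / j) * s j + ξ j) :
    s n = growth a n / growth a m * s m +
      ∑ i ∈ Finset.Ico m n, growth a n / growth a (i + 1) * ξ i := by
  induction n, hmn using Nat.le_induction with
  | base => simp [div_self (growth_pos ha m).ne']
  | succ n hmn ih =>
    rw [hs n hmn, ih, Finset.sum_Ico_succ_top hmn, div_self (growth_pos ha _).ne', one_mul,
      mul_add, Finset.mul_sum, growth_succ, ← add_assoc]
    congr 2
    · ring
    · exact Finset.sum_congr rfl fun i _ => by ring

/-- Variance accumulated over the time interval `[m, n)`. -/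
def blockVar (a : ℝ) (m n : ℕ) : ℝ := ∑ i ∈ Finset.Ico m n, (growth a n / growth a (i + 1)) ^ 2

lemma blockVar_nonneg (a : ℝ) (m n : ℕ) : 0 ≤ blockVar a m n :=
  Finset.sum_nonneg fun _ _ => sq_nonneg _

lemma blockVar_eq_sub {a : ℝ} (ha : -1 < a) {m n : ℕ} (hm : 1 ≤ m) (hmn : m ≤ n) :
    blockVar a m n = blockVar a 1 n - (growth a n / growth a m) ^ 2 * blockVar a 1 m := by
  rw [eq_sub_iff_add_eq', blockVar, blockVar, blockVar, Finset.mul_sum,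
    ← Finset.sum_Ico_consecutive _ hm hmn]
  congr 1
  refine Finset.sum_congr rfl fun i _ => ?_
  rw [← mul_pow, div_mul_div_cancel₀ (growth_pos ha m).ne']

lemma blockVar_succ {a : ℝ} (ha : -1 < a) {n : ℕ} (hn : 1 ≤ n) :
    blockVar a 1 (n + 1) = (1 + a / n) ^ 2 * blockVar a 1 n + 1 := by
  rw [blockVar, Finset.sum_Ico_succ_top hn, div_self (growth_pos ha _).ne', one_pow, blockVar,
    Finset.mul_sum]
  congr 1
  refine Finset.sum_congr rfl fun i _ => ?_
  rw [growth_succ]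
  ring

lemma tendsto_blockVar_div {a : ℝ} (ha : -1 < a) (ha2 : a < 1 / 2) :
    Tendsto (fun n : ℕ => blockVar a 1 n / n) atTop (nhds (1 / (1 - 2 * a))) := by
  set b : ℝ := max a (1 / 4) with hb
  have hb0 : 0 < b := lt_max_of_lt_right (by norm_num)
  have hb2 : b < 1 / 2 := max_lt ha2 (by norm_num)
  have hab : a ≤ b := le_max_left _ _
  have hd : 0 < 1 - 2 * a := by linarith
  set d : ℝ := a ^ 2 / (1 - 2 * a) with hddef
  have hd0 : 0 ≤ d := by positivity
  set u : ℕ → ℝ := fun n => blockVar a 1 n - n / (1 - 2 * a) with hu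
  have hform : ∀ n ≥ 1, u n = growth a n ^ 2 *
      (u 1 + ∑ i ∈ Finset.Ico 1 n, d / (i * growth a (i + 1) ^ 2)) := by
    intro n hn
    induction n, hn using Nat.le_induction with
    | base => simp [growth_one]
    | succ n hn ih =>
      have hn0 : (n : ℝ) ≠ 0 := by positivity
      have hg := (growth_pos ha n).ne'
      have hg' := (growth_pos ha (n + 1)).ne'
      have hd' := hd.ne'
      have hrec : u (n + 1) = (1 + a / n) ^ 2 * u n + d / n := by
        simp only [hu, hddef]
        rw [blockVar_succ ha hn]
        push_cast
        field_simp
        linear_combination (-(n : ℝ) ^ 2) * mul_inv_cancel₀ hd'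
      have hlast : growth a (n + 1) ^ 2 * (d / (n * growth a (n + 1) ^ 2)) = d / n := by
        field_simp
      rw [hrec, ih, Finset.sum_Ico_succ_top hn, ← add_assoc, mul_add (growth a (n + 1) ^ 2), hlast,
        growth_succ]
      ring
  have hsummable : Summable (fun i : ℕ => 1 / (i : ℝ) ^ (1 + 2 * b)) :=
    Real.summable_one_div_nat_rpow.2 (by linarith)
  set Z := ∑' i : ℕ, 1 / (i : ℝ) ^ (1 + 2 * b)
  set C := Real.exp 1 ^ 2 * (|u 1| + d * Z) with hC
  have hbound : ∀ n ≥ 1, |u n| ≤ C * (n : ℝ) ^ (2 * b) := by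
    intro n hn
    have hn0 : (0 : ℝ) < n := by exact_mod_cast hn
    have hgn : ∀ m, 1 ≤ m → m ≤ n → (growth a n / growth a m) ^ 2 ≤
        Real.exp 1 ^ 2 * ((n : ℝ) ^ (2 * b) / (m : ℝ) ^ (2 * b)) := by
      intro m hm hmn
      have := pow_le_pow_left₀ (div_nonneg (growth_pos ha n).le (growth_pos ha m).le)
        (growth_div_le ha hab hb0.le (by linarith) hm hmn) 2
      rwa [mul_pow, ← Real.rpow_mul_natCast (by positivity), Real.div_rpow (by positivity)
        (by positivity), Nat.cast_two, mul_comm b] at this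
    have h1 := hgn 1 le_rfl hn
    rw [growth_one, div_one, Nat.cast_one, Real.one_rpow, div_one] at h1
    rw [hform n hn, mul_add, Finset.mul_sum]
    refine (abs_add_le _ _).trans ?_
    rw [abs_mul, abs_of_nonneg (sq_nonneg _), hC, mul_add, add_mul]
    refine add_le_add ?_ ?_
    · calc _ ≤ Real.exp 1 ^ 2 * (n : ℝ) ^ (2 * b) * |u 1| := by gcongr
        _ = _ := by ring
    · have hterm : ∀ i ∈ Finset.Ico 1 n, |growth a n ^ 2 * (d / (i * growth a (i + 1) ^ 2))| ≤
          Real.exp 1 ^ 2 * d * (n : ℝ) ^ (2 * b) * (1 / (i : ℝ) ^ (1 + 2 * b)) := by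
        intro i hi
        obtain ⟨hi1, hin⟩ := Finset.mem_Ico.1 hi
        have hi0 : (0 : ℝ) < i := by exact_mod_cast hi1
        have h2 := hgn (i + 1) (by omega) hin
        rw [abs_of_nonneg (by positivity), Real.rpow_add hi0, Real.rpow_one]
        calc growth a n ^ 2 * (d / (i * growth a (i + 1) ^ 2)) =
              (growth a n / growth a (i + 1)) ^ 2 * (d / i) := by
              have := (growth_pos ha (i + 1)).ne'
              field_simp
          _ ≤ Real.exp 1 ^ 2 * ((n : ℝ) ^ (2 * b) / ((i + 1 : ℕ) : ℝ) ^ (2 * b)) * (d / i) := by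
              gcongr
          _ ≤ Real.exp 1 ^ 2 * ((n : ℝ) ^ (2 * b) / (i : ℝ) ^ (2 * b)) * (d / i) := by
              gcongr
              omega
          _ = _ := by field_simp
      refine (Finset.abs_sum_le_sum_abs _ _).trans ((Finset.sum_le_sum hterm).trans ?_)
      rw [← Finset.mul_sum]
      calc _ ≤ Real.exp 1 ^ 2 * d * (n : ℝ) ^ (2 * b) * Z := by
            gcongr
            exact hsummable.sum_le_tsum _ fun i _ => by positivity
        _ = _ := by ring
  have hzero : Tendsto (fun n : ℕ => u n / n) atTop (nhds 0) := by
    have hlim : Tendsto (fun n : ℕ => C * (n : ℝ) ^ (-(1 - 2 * b))) atTop (nhds 0) := by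
      simpa using ((tendsto_rpow_neg_atTop (by linarith : 0 < 1 - 2 * b)).comp
        tendsto_natCast_atTop_atTop).const_mul C
    refine squeeze_zero_norm' ?_ hlim
    filter_upwards [eventually_ge_atTop 1] with n hn
    have hn0 : (0 : ℝ) < n := by exact_mod_cast hn
    rw [norm_div, Real.norm_natCast, Real.norm_eq_abs, div_le_iff₀ hn0]
    refine (hbound n hn).trans (le_of_eq ?_)
    have : (n : ℝ) ^ (2 * b) = (n : ℝ) ^ (-(1 - 2 * b)) * n := by
      rw [← Real.rpow_add_one hn0.ne']
      congr 1
      ring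
    rw [this, ← mul_assoc]
  have := hzero.add_const (1 / (1 - 2 * a))
  rw [zero_add] at this
  refine this.congr' ?_
  filter_upwards [eventually_ge_atTop 1] with n hn
  have hn0 : (n : ℝ) ≠ 0 := by positivity
  simp only [hu]
  field_simp
  ring

/-- A function of a finite sign pattern, expanded over all patterns. -/
lemma sum_piFinset_sign_ite {n : ℕ} (y : Fin n → ℤ) (hy : ∀ i, y i = 1 ∨ y i = -1)
    (F : (Fin n → ℤ) → ℝ) :
    ∑ z ∈ Fintype.piFinset (fun _ : Fin n => ({1, -1} : Finset ℤ)), (if y = z then F z else 0) =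
      F y := by
  rw [Finset.sum_ite_eq, if_pos]
  simpa [Fintype.mem_piFinset] using hy

lemma memory_weight_eq {p : ℝ} {ε x : ℤ} (hε : ε = 1 ∨ ε = -1) (hx : x = 1 ∨ x = -1) :
    p * (if ε = x then 1 else 0) + (1 - p) * (if ε = -x then 1 else 0) =
      (1 + (2 * p - 1) * ε * x) / 2 := by
  rcases hε with rfl | rfl <;> rcases hx with rfl | rfl <;> norm_num <;> ring

namespace IsERW

variable {Ω : Type*} [MeasurableSpace Ω] {P : Measure Ω} {p q : ℝ} {X : ℕ → Ω → ℤ}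

lemma measureReal_cylinder (hX : IsERW P p q X) (n : ℕ) :
    ∀ ε : ℕ → ℤ, (∀ i, ε i = 1 ∨ ε i = -1) → ∃ K : ℝ, ∀ x : ℤ, x = 1 ∨ x = -1 →
      P.real {ω | (∀ i < n + 1, X i ω = ε i) ∧ X (n + 1) ω = x} =
        K * ((1 + (2 * p - 1) * (∑ i ∈ Finset.range (n + 1), (ε i : ℝ)) / (n + 1 : ℕ) * x) /
          2) := by
  intro ε hε
  refine ⟨(if ε 0 = 1 then q else 1 - q) * ∏ m ∈ Finset.range n, ((1 : ℝ) / (m + 1) *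
    ∑ i ∈ Finset.range (m + 1), (p * (if ε i = ε (m + 1) then 1 else 0) +
      (1 - p) * (if ε i = -ε (m + 1) then 1 else 0))), fun x hx => ?_⟩
  · have h := hX.2.2 (n + 1) (fun i => if i < n + 1 then ε i else x) (fun i => by
      split_ifs
      exacts [hε i, hx])
    have hset : {ω | (∀ i < n + 1, X i ω = ε i) ∧ X (n + 1) ω = x} =
        {ω | ∀ i ≤ n + 1, X i ω = if i < n + 1 then ε i else x} := by
      ext ω
      constructor
      · rintro ⟨h1, h2⟩ i hi
        split_ifs with hlt
        · exact h1 i hlt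
        · obtain rfl : i = n + 1 := by omega
          exact h2
      · intro h
        refine ⟨fun i hi => ?_, ?_⟩
        · simpa [hi] using h i hi.le
        · simpa using h (n + 1) le_rfl
    rw [hset, measureReal_def, h, Finset.prod_range_succ, ← mul_assoc]
    refine congrArg₂ _ ?_ ?_
    · refine congrArg₂ (· * ·) (by rw [if_pos (Nat.succ_pos n)]) ?_
      refine Finset.prod_congr rfl fun m hm => ?_
      have hm := Finset.mem_range.1 hm
      refine congrArg₂ _ rfl (Finset.sum_congr rfl fun i hi => ?_)
      have hi := Finset.mem_range.1 hi
      rw [if_pos (show i < n + 1 by omega), if_pos (show m + 1 < n + 1 by omega)]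
    · have : ∀ i ∈ Finset.range (n + 1),
          (p * (if (if i < n + 1 then ε i else x) = (if n + 1 < n + 1 then ε (n + 1) else x)
            then (1 : ℝ) else 0) + (1 - p) * (if (if i < n + 1 then ε i else x) =
            -(if n + 1 < n + 1 then ε (n + 1) else x) then 1 else 0)) =
          (1 + (2 * p - 1) * ε i * x) / 2 := by
        intro i hi
        rw [if_pos (Finset.mem_range.1 hi), if_neg (lt_irrefl _)]
        exact memory_weight_eq (hε i) hx
      rw [Finset.sum_congr rfl this, ← Finset.sum_div, Finset.sum_add_distrib, ← Finset.sum_mul,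
        ← Finset.mul_sum]
      have : (n + 1 : ℝ) ≠ 0 := by positivity
      simp
      field_simp

/-- The conditional mean of the next step given the past. -/
lemma integral_mul_sub_eq_zero [IsProbabilityMeasure P] (hX : IsERW P p q X) {n : ℕ} (hn : 1 ≤ n)
    {f : Ω → ℝ} (hf : Past X n f) :
    ∫ ω, f ω * (X n ω - (2 * p - 1) * (∑ i ∈ Finset.range n, (X i ω : ℝ)) / n) ∂P = 0 := by
  obtain ⟨n, rfl⟩ : ∃ k, n = k + 1 := ⟨n - 1, by omega⟩
  obtain ⟨g, hg⟩ := hf.exists_eq_comp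
  let c : (Fin (n + 1) → ℤ) → ℝ := fun y => (2 * p - 1) * (∑ i, (y i : ℝ)) / (n + 1 : ℕ)
  let A : (Fin (n + 1) → ℤ) → ℤ → Set Ω := fun y x =>
    {ω | (fun i : Fin (n + 1) => X i ω) = y ∧ X (n + 1) ω = x}
  have hA : ∀ y x, MeasurableSet (A y x) := fun y x =>
    (measurable_pi_lambda (fun ω (i : Fin (n + 1)) => X i ω) (fun i => hX.1 i)
      (measurableSet_singleton y)).inter (hX.1 (n + 1) (measurableSet_singleton x))
  have hpt : ∀ ω, f ω * (X (n + 1) ω -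
      (2 * p - 1) * (∑ i ∈ Finset.range (n + 1), (X i ω : ℝ)) / (n + 1 : ℕ)) =
      ∑ y ∈ Fintype.piFinset (fun _ : Fin (n + 1) => ({1, -1} : Finset ℤ)),
        ((A y 1).indicator (fun _ => g y * (1 - c y)) ω +
          (A y (-1)).indicator (fun _ => g y * (-1 - c y)) ω) := by
    intro ω
    have h1 := sum_piFinset_sign_ite (fun i : Fin (n + 1) => X i ω) (fun i => hX.2.1 i ω)
      (fun y => g y * (X (n + 1) ω - c y))
    rw [hg ω, Finset.sum_range, ← h1]
    refine Finset.sum_congr rfl fun y _ => ?_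
    by_cases hy : (fun i : Fin (n + 1) => X i ω) = y
    · rcases hX.2.1 (n + 1) ω with hx | hx <;> simp [A, Set.indicator, hy, hx]
    · simp [A, Set.indicator, hy]
  have h_int : ∀ y x (b : ℝ), Integrable ((A y x).indicator (fun _ => b)) P := fun y x b =>
    (integrable_const b).indicator (hA y x)
  simp_rw [hpt]
  rw [integral_finsetSum _ fun y _ => by exact (h_int y 1 _).add (h_int y (-1) _)]
  refine Finset.sum_eq_zero fun y hy => ?_
  rw [integral_add (h_int y 1 _) (h_int y (-1) _), integral_indicator_const _ (hA y 1),
    integral_indicator_const _ (hA y (-1))]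
  obtain ⟨K, hK⟩ := hX.measureReal_cylinder n (fun i => if h : i < n + 1 then y ⟨i, h⟩ else 1)
    (fun i => by
      split_ifs
      · simpa using Fintype.mem_piFinset.1 hy _
      · exact Or.inl rfl)
  have hP : ∀ x : ℤ, x = 1 ∨ x = -1 → P.real (A y x) = K * ((1 + c y * x) / 2) := by
    intro x hx
    have hset : A y x = {ω | (∀ i < n + 1, X i ω = if h : i < n + 1 then y ⟨i, h⟩ else 1) ∧
        X (n + 1) ω = x} := by
      ext ω
      refine and_congr_left fun _ => ⟨fun h i hi => ?_, fun h => funext fun i => ?_⟩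
      · rw [dif_pos hi]
        exact congrFun h ⟨i, hi⟩
      · have := h i i.2
        rwa [dif_pos i.2] at this
    rw [hset, hK x hx, Finset.sum_range]
    simp only [Fin.is_lt, dif_pos, Fin.eta, c]
  rw [hP 1 (Or.inl rfl), hP (-1) (Or.inr rfl), smul_eq_mul, smul_eq_mul]
  push_cast
  ring

end IsERW

/-- A vanishing conditional mean survives conditioning on an independent `±1`-valued sequence. -/
lemma integral_mul_eq_zero_of_indepFun {Ω : Type*} [MeasurableSpace Ω] {P : Measure Ω}
    [IsProbabilityMeasure P] {X X' : ℕ → Ω → ℤ} (hX : ∀ n, Measurable (X n))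
    (hXs : ∀ n ω, X n ω = 1 ∨ X n ω = -1) (hX' : ∀ n, Measurable (X' n))
    (hXs' : ∀ n ω, X' n ω = 1 ∨ X' n ω = -1)
    (hindep : IndepFun (fun ω n => X n ω) (fun ω n => X' n ω) P) {m n l : ℕ} (hnl : n ≤ l)
    {h : Ω → ℝ} (hh : Past X' l h)
    (hmean : ∀ f : Ω → ℝ, Past X' n f → ∫ ω, f ω * h ω ∂P = 0) {f : Ω → ℝ}
    (hf : ∀ ω ω', (∀ i < m, X i ω = X i ω') → (∀ i < n, X' i ω = X' i ω') → f ω = f ω') :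
    ∫ ω, f ω * h ω ∂P = 0 := by
  have hfac : Function.FactorsThrough f
      (fun ω => ((fun i : Fin m => X i ω), (fun i : Fin n => X' i ω))) := by
    intro ω ω' h
    exact hf ω ω' (fun i hi => congrFun (congrArg Prod.fst h) ⟨i, hi⟩)
      (fun i hi => congrFun (congrArg Prod.snd h) ⟨i, hi⟩)
  obtain ⟨g, hg⟩ := (Function.factorsThrough_iff _).1 hfac
  have hpast : ∀ u, Past X' n (fun ω => g (u, fun i : Fin n => X' i ω)) := by
    intro u ω ω' h
    have : (fun i : Fin n => X' i ω) = fun i : Fin n => X' i ω' := funext fun i => h i i.2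
    simp only [this]
  let φ : (Fin m → ℤ) → Ω → ℝ := fun u ω => if (fun i : Fin m => X i ω) = u then 1 else 0
  have hφ : ∀ u, Past X m (φ u) := by
    intro u ω ω' h
    have : (fun i : Fin m => X i ω) = fun i : Fin m => X i ω' := funext fun i => h i i.2
    simp only [φ, this]
  have hprod : ∀ u, Past X' l (fun ω => g (u, fun i : Fin n => X' i ω) * h ω) := fun u =>
    ((hpast u).mono hnl).mul hh
  have hind : ∀ u, IndepFun (φ u) (fun ω => g (u, fun i : Fin n => X' i ω) * h ω) P := by
    intro u
    obtain ⟨G, hG⟩ := (hφ u).exists_eq_comp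
    obtain ⟨H, hH⟩ := (hprod u).exists_eq_comp
    have h1 : φ u = (fun z : ℕ → ℤ => G fun i : Fin m => z i) ∘ fun ω n => X n ω := funext hG
    have h2 : (fun ω => g (u, fun i : Fin n => X' i ω) * h ω) =
      (fun z : ℕ → ℤ => H fun i : Fin l => z i) ∘ fun ω n => X' n ω := funext hH
    rw [h1, h2]
    exact hindep.comp
      (Measurable.of_discrete.comp (measurable_pi_lambda _ fun i => measurable_pi_apply _))
      (Measurable.of_discrete.comp (measurable_pi_lambda _ fun i => measurable_pi_apply _))
  have hpt : ∀ ω, f ω * h ω =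
      ∑ u ∈ Fintype.piFinset (fun _ : Fin m => ({1, -1} : Finset ℤ)),
        φ u ω * (g (u, fun i : Fin n => X' i ω) * h ω) := by
    intro ω
    have h1 := sum_piFinset_sign_ite (fun i : Fin m => X i ω) (fun i => hXs i ω)
      (fun u => g (u, fun i : Fin n => X' i ω) * h ω)
    rw [show f ω = g ((fun i : Fin m => X i ω), fun i : Fin n => X' i ω) from congrFun hg ω, ← h1]
    refine Finset.sum_congr rfl fun u _ => ?_
    simp only [φ, ite_mul, one_mul, zero_mul]
  have hi1 : ∀ u, Integrable (φ u) P := fun u => (hφ u).integrable hX hXs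
  have hi2 : ∀ u, Integrable (fun ω => g (u, fun i : Fin n => X' i ω) * h ω) P := fun u =>
    (hprod u).integrable hX' hXs'
  simp_rw [hpt]
  rw [integral_finsetSum _ fun u _ => by exact (hind u).integrable_mul (hi1 u) (hi2 u)]
  refine Finset.sum_eq_zero fun u _ => ?_
  rw [(hind u).integral_fun_mul_eq_mul_integral (hi1 u).aestronglyMeasurable
    (hi2 u).aestronglyMeasurable, hmean _ (hpast u), mul_zero]

/-- Alternate the terms of two sequences: `f 0, g 0, f 1, g 1, …`. -/
def interleave {β : Type*} (f g : ℕ → β) (k : ℕ) : β := if k % 2 = 0 then f (k / 2) else g (k / 2)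

lemma interleave_even {β : Type*} (f g : ℕ → β) (i : ℕ) : interleave f g (2 * i) = f i := by
  simp [interleave]

lemma interleave_odd {β : Type*} (f g : ℕ → β) (i : ℕ) : interleave f g (2 * i + 1) = g i := by
  have h1 : (2 * i + 1) % 2 = 1 := by omega
  have h2 : (2 * i + 1) / 2 = i := by omega
  simp [interleave, h1, h2]

lemma sum_Ico_two_mul {β : Type*} [AddCommMonoid β] (F : ℕ → β) {m n : ℕ} (hmn : m ≤ n) :
    ∑ k ∈ Finset.Ico (2 * m) (2 * n), F k =
      ∑ i ∈ Finset.Ico m n, (F (2 * i) + F (2 * i + 1)) := by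
  induction n, hmn using Nat.le_induction with
  | base => simp
  | succ n hmn ih =>
    rw [Finset.sum_Ico_succ_top hmn, ← ih, show 2 * (n + 1) = 2 * n + 1 + 1 by ring,
      Finset.sum_Ico_succ_top (by omega), Finset.sum_Ico_succ_top (by omega), add_assoc]

lemma past_interleave_left {Ω α β : Type*} {X X' : ℕ → Ω → α} {n : ℕ} {f : Ω → β}
    (hf : Past X n f) : Past (interleave X X') (2 * n) f := fun ω ω' h =>
  hf ω ω' fun i hi => by simpa only [interleave_even] using h (2 * i) (by omega)

lemma past_interleave_right {Ω α β : Type*} {X X' : ℕ → Ω → α} {n : ℕ} {f : Ω → β}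
    (hf : Past X' n f) : Past (interleave X X') (2 * n) f := fun ω ω' h =>
  hf ω ω' fun i hi => by simpa only [interleave_odd] using h (2 * i + 1) (by omega)

/-- The conditional mean of the step following the first `n` steps. -/
def drift {Ω : Type*} (a : ℝ) (X : ℕ → Ω → ℤ) (n : ℕ) (ω : Ω) : ℝ :=
  a * (∑ i ∈ Finset.range n, (X i ω : ℝ)) / n

lemma past_drift {Ω : Type*} (a : ℝ) (X : ℕ → Ω → ℤ) (n : ℕ) : Past X n (drift a X n) := by
  have h : Past X n (fun ω => ∑ i ∈ Finset.range n, (X i ω : ℝ)) :=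
    Past.sum fun i hi => (Past.term (Finset.mem_range.1 hi)).comp _
  exact h.comp fun s => a * s / n

lemma abs_sum_sign_le {Ω : Type*} {X : ℕ → Ω → ℤ} (hX : ∀ n ω, X n ω = 1 ∨ X n ω = -1) (n : ℕ)
    (ω : Ω) : |∑ i ∈ Finset.range n, (X i ω : ℝ)| ≤ n := by
  refine (Finset.abs_sum_le_sum_abs _ _).trans ?_
  calc _ ≤ ∑ i ∈ Finset.range n, (1 : ℝ) := by
        refine Finset.sum_le_sum fun i _ => ?_
        rcases hX i ω with h | h <;> simp [h]
    _ = n := by simp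

lemma abs_drift_le {Ω : Type*} {a : ℝ} (ha : |a| ≤ 1) {X : ℕ → Ω → ℤ}
    (hX : ∀ n ω, X n ω = 1 ∨ X n ω = -1) (n : ℕ) (ω : Ω) : |drift a X n ω| ≤ 1 := by
  rw [drift, abs_div, Nat.abs_cast, abs_mul]
  refine div_le_one_of_le₀ ?_ (Nat.cast_nonneg n)
  calc _ ≤ 1 * (n : ℝ) := mul_le_mul ha (abs_sum_sign_le hX n ω) (abs_nonneg _) zero_le_one
    _ = n := one_mul _

lemma isSignSequence_interleave {Ω : Type*} [MeasurableSpace Ω] {P : Measure Ω}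
    [IsProbabilityMeasure P] {p p' q q' : ℝ} (hp0 : 0 ≤ p) (hp1 : p ≤ 1) (hp0' : 0 ≤ p')
    (hp1' : p' ≤ 1) {X X' : ℕ → Ω → ℤ} (hX : IsERW P p q X) (hX' : IsERW P p' q' X')
    (hindep : IndepFun (fun ω n => X n ω) (fun ω n => X' n ω) P) :
    IsSignSequence P 2 (interleave X X')
      (interleave (drift (2 * p - 1) X) (drift (2 * p' - 1) X')) := by
  have hpar : ∀ k, ∃ i, k = 2 * i ∨ k = 2 * i + 1 := fun k => ⟨k / 2, by omega⟩
  have hmeas : ∀ k, Measurable (interleave X X' k) := by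
    intro k
    obtain ⟨i, rfl | rfl⟩ := hpar k
    · rw [interleave_even]; exact hX.1 i
    · rw [interleave_odd]; exact hX'.1 i
  have hsign : ∀ k ω, interleave X X' k ω = 1 ∨ interleave X X' k ω = -1 := by
    intro k ω
    obtain ⟨i, rfl | rfl⟩ := hpar k
    · rw [interleave_even]; exact hX.2.1 i ω
    · rw [interleave_odd]; exact hX'.2.1 i ω
  have hpast : ∀ k, Past (interleave X X') k
      (interleave (drift (2 * p - 1) X) (drift (2 * p' - 1) X') k) := by
    intro k
    obtain ⟨i, rfl | rfl⟩ := hpar k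
    · rw [interleave_even]; exact past_interleave_left (past_drift _ _ _)
    · rw [interleave_odd]; exact (past_interleave_right (past_drift _ _ _)).mono (by omega)
  refine ⟨hmeas, hsign, hpast, ?_, ?_⟩
  · intro k ω
    obtain ⟨i, rfl | rfl⟩ := hpar k
    · rw [interleave_even]
      exact abs_drift_le (abs_le.2 ⟨by linarith, by linarith⟩) hX.2.1 i ω
    · rw [interleave_odd]
      exact abs_drift_le (abs_le.2 ⟨by linarith, by linarith⟩) hX'.2.1 i ω
  · intro k hk f hf
    have hi1 : Integrable (fun ω => f ω * interleave X X' k ω) P :=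
      Past.integrable (n := k + 1) hmeas hsign
        ((hf.mono k.le_succ).mul ((Past.term k.lt_succ_self).comp _))
    have hi2 : Integrable (fun ω => f ω *
        interleave (drift (2 * p - 1) X) (drift (2 * p' - 1) X') k ω) P :=
      Past.integrable hmeas hsign (hf.mul (hpast k))
    rw [← sub_eq_zero, ← integral_sub hi1 hi2]
    simp_rw [← mul_sub]
    have hsub : ∀ (a : ℝ) (Z : ℕ → Ω → ℤ) (i : ℕ),
        Past Z (i + 1) (fun ω => (Z i ω : ℝ) - drift a Z i ω) := fun a Z i =>
      ((Past.term i.lt_succ_self).comp _).sub ((past_drift a Z i).mono i.le_succ)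
    obtain ⟨i, rfl | rfl⟩ := hpar k
    · simp_rw [interleave_even]
      refine integral_mul_eq_zero_of_indepFun hX'.1 hX'.2.1 hX.1 hX.2.1 hindep.symm
        (m := i) (n := i) (l := i + 1) i.le_succ (hsub _ X i)
        (fun g hg => hX.integral_mul_sub_eq_zero (by omega) hg) ?_
      intro ω ω' h' h
      refine hf ω ω' fun k hk => ?_
      obtain ⟨j, rfl | rfl⟩ := hpar k
      · simpa only [interleave_even] using h j (by omega)
      · simpa only [interleave_odd] using h' j (by omega)
    · simp_rw [interleave_odd]
      refine integral_mul_eq_zero_of_indepFun hX.1 hX.2.1 hX'.1 hX'.2.1 hindep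
        (m := i + 1) (n := i) (l := i + 1) i.le_succ (hsub _ X' i)
        (fun g hg => hX'.integral_mul_sub_eq_zero (by omega) hg) ?_
      intro ω ω' h h'
      refine hf ω ω' fun k hk => ?_
      obtain ⟨j, rfl | rfl⟩ := hpar k
      · simpa only [interleave_even] using h j (by omega)
      · simpa only [interleave_odd] using h' j (by omega)

/-- The position after `n` steps. -/
def walk {Ω : Type*} (X : ℕ → Ω → ℤ) (n : ℕ) (ω : Ω) : ℝ := ∑ i ∈ Finset.range n, (X i ω : ℝ)

lemma walk_succ_eq {Ω : Type*} (a : ℝ) (X : ℕ → Ω → ℤ) (n : ℕ) (ω : Ω) :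
    walk X (n + 1) ω = (1 + a / n) * walk X n ω + (X n ω - drift a X n ω) := by
  rw [walk, Finset.sum_range_succ, drift, walk]
  ring

lemma walk_eq_growth_mul_add_sum {Ω : Type*} {a : ℝ} (ha : -1 < a) (X : ℕ → Ω → ℤ) {m n : ℕ}
    (hmn : m ≤ n) (ω : Ω) :
    walk X n ω = growth a n / growth a m * walk X m ω +
      ∑ i ∈ Finset.Ico m n, growth a n / growth a (i + 1) * (X i ω - drift a X i ω) :=
  eq_growth_mul_add_sum (s := fun n => walk X n ω) ha hmn fun j _ => walk_succ_eq a X j ω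

/-- Coefficients of the innovations in the linear combination `α S_n + β S'_n`. -/
def innovCoef (a a' α β : ℝ) (n : ℕ) : ℕ → ℝ :=
  interleave (fun i => α * (growth a n / growth a (i + 1)))
    (fun i => β * (growth a' n / growth a' (i + 1)))

lemma combo_eq {Ω : Type*} {a a' : ℝ} (ha : -1 < a) (ha' : -1 < a') (X X' : ℕ → Ω → ℤ) (α β : ℝ)
    {m n : ℕ} (hmn : m ≤ n) (ω : Ω) :
    α * walk X n ω + β * walk X' n ω =
      (α * (growth a n / growth a m * walk X m ω) +
        β * (growth a' n / growth a' m * walk X' m ω)) +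
      ∑ k ∈ Finset.Ico (2 * m) (2 * n), innovCoef a a' α β n k *
        (interleave X X' k ω - interleave (drift a X) (drift a' X') k ω) := by
  rw [sum_Ico_two_mul _ hmn, walk_eq_growth_mul_add_sum ha X hmn,
    walk_eq_growth_mul_add_sum ha' X' hmn, Finset.sum_add_distrib]
  simp only [innovCoef, interleave_even, interleave_odd, mul_assoc, ← Finset.mul_sum]
  ring

lemma sum_innovCoef_sq (a a' α β : ℝ) {m n : ℕ} (hmn : m ≤ n) :
    ∑ k ∈ Finset.Ico (2 * m) (2 * n), innovCoef a a' α β n k ^ 2 =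
      α ^ 2 * blockVar a m n + β ^ 2 * blockVar a' m n := by
  rw [sum_Ico_two_mul _ hmn, blockVar, blockVar, Finset.mul_sum, Finset.mul_sum,
    ← Finset.sum_add_distrib]
  simp only [innovCoef, interleave_even, interleave_odd, mul_pow]

/-- The normalization of the law of the iterated logarithm. -/
def lilScale (n : ℕ) : ℝ := Real.sqrt (2 * n * Real.log (Real.log n))

lemma lilScale_nonneg (n : ℕ) : 0 ≤ lilScale n := Real.sqrt_nonneg _

lemma tendsto_log_log_natCast : Tendsto (fun n : ℕ => Real.log (Real.log n)) atTop atTop :=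
  Real.tendsto_log_atTop.comp (Real.tendsto_log_atTop.comp tendsto_natCast_atTop_atTop)

lemma one_le_log_natCast {n : ℕ} (hn : 3 ≤ n) : 1 ≤ Real.log n := by
  rw [Real.le_log_iff_exp_le (by positivity)]
  have h1 := Real.exp_one_lt_d9
  have h2 : (3 : ℝ) ≤ n := by exact_mod_cast hn
  linarith

lemma lilScale_mono {m n : ℕ} (hm : 3 ≤ m) (hmn : m ≤ n) : lilScale m ≤ lilScale n := by
  have h1 := one_le_log_natCast hm
  have h2 : Real.log m ≤ Real.log n :=
    Real.log_le_log (by positivity) (by exact_mod_cast hmn)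
  have h3 : 0 ≤ Real.log (Real.log m) := Real.log_nonneg h1
  have h4 : Real.log (Real.log m) ≤ Real.log (Real.log n) := Real.log_le_log (by linarith) h2
  have h5 : (m : ℝ) ≤ n := by exact_mod_cast hmn
  unfold lilScale
  gcongr

lemma lilScale_sq {n : ℕ} (hn : 3 ≤ n) : lilScale n ^ 2 = 2 * n * Real.log (Real.log n) :=
  Real.sq_sqrt (mul_nonneg (by positivity) (Real.log_nonneg (one_le_log_natCast hn)))

lemma eventually_sqrt_le_lilScale : ∀ᶠ n : ℕ in atTop, Real.sqrt n ≤ lilScale n := by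
  filter_upwards [tendsto_log_log_natCast.eventually_ge_atTop 1] with n hn
  refine Real.sqrt_le_sqrt ?_
  have : (0 : ℝ) ≤ n := n.cast_nonneg
  nlinarith

lemma eventually_rpow_le_lilScale {b : ℝ} (hb : b < 1 / 2) (C : ℝ) {ε : ℝ} (hε : 0 < ε) :
    ∀ᶠ n : ℕ in atTop, C * (n : ℝ) ^ b ≤ ε * lilScale n := by
  have hlim : Tendsto (fun n : ℕ => C * (n : ℝ) ^ (-(1 / 2 - b))) atTop (nhds 0) := by
    simpa using ((tendsto_rpow_neg_atTop (by linarith : 0 < 1 / 2 - b)).comp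
      tendsto_natCast_atTop_atTop).const_mul C
  filter_upwards [hlim.eventually_le_const hε, eventually_sqrt_le_lilScale,
    eventually_ge_atTop 1] with n h1 h2 hn
  have hn0 : (0 : ℝ) < n := by exact_mod_cast hn
  have : (n : ℝ) ^ b = (n : ℝ) ^ (-(1 / 2 - b)) * Real.sqrt n := by
    rw [Real.sqrt_eq_rpow, ← Real.rpow_add hn0]
    congr 1
    ring
  rw [this, ← mul_assoc]
  exact mul_le_mul h1 h2 (Real.sqrt_nonneg _) hε.le

/-- Summability along a sequence that grows at least geometrically. -/
lemma summable_exp_neg_log_log {ν : ℕ → ℕ} {c s : ℝ} (hc : 0 < c) (hs : 1 < s)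
    (hlog : ∀ᶠ k : ℕ in atTop, c * k ≤ Real.log (ν k)) :
    Summable (fun k => Real.exp (-(s * Real.log (Real.log (ν k))))) := by
  have h : Summable (fun k : ℕ => c ^ (-s) * (1 / (k : ℝ) ^ s)) :=
    (Real.summable_one_div_nat_rpow.2 hs).mul_left _
  refine Summable.of_norm_bounded_eventually_nat h ?_
  filter_upwards [hlog, eventually_ge_atTop 1] with k hk hk1
  have hk0 : (0 : ℝ) < k := by exact_mod_cast hk1
  rw [Real.norm_eq_abs, Real.abs_exp]
  calc Real.exp (-(s * Real.log (Real.log (ν k)))) ≤ Real.exp (-(s * Real.log (c * k))) := by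
        gcongr
    _ = (c * k) ^ (-s) := by
        rw [Real.rpow_def_of_pos (by positivity)]
        congr 1
        ring
    _ = _ := by rw [Real.mul_rpow hc.le hk0.le, Real.rpow_neg hk0.le, one_div]

lemma ae_eventually_notMem_of_summable {Ω : Type*} [MeasurableSpace Ω] {P : Measure Ω}
    [IsFiniteMeasure P] {E : ℕ → Set Ω} {u : ℕ → ℝ} (hu : Summable u)
    (hE : ∀ᶠ k in atTop, P.real (E k) ≤ u k) : ∀ᵐ ω ∂P, ∀ᶠ k in atTop, ω ∉ E k := by
  refine ae_eventually_notMem ?_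
  have h : Summable (fun k => P.real (E k)) := by
    refine Summable.of_norm_bounded_eventually_nat hu ?_
    filter_upwards [hE] with k hk
    rwa [Real.norm_eq_abs, abs_of_nonneg measureReal_nonneg]
  simpa using h.tsum_ofReal_ne_top

lemma eventually_combo_blockVar_lt {a a' α β v : ℝ} (ha : -1 < a) (ha2 : a < 1 / 2)
    (ha' : -1 < a') (ha2' : a' < 1 / 2)
    (hv : α ^ 2 * (1 / (1 - 2 * a)) + β ^ 2 * (1 / (1 - 2 * a')) < v) :
    ∀ᶠ n : ℕ in atTop, α ^ 2 * blockVar a 1 n + β ^ 2 * blockVar a' 1 n ≤ v * n := by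
  have := ((tendsto_blockVar_div ha ha2).const_mul (α ^ 2)).add
    ((tendsto_blockVar_div ha' ha2').const_mul (β ^ 2))
  filter_upwards [this.eventually_le_const hv, eventually_ge_atTop 1] with n hn hn1
  have hn0 : (0 : ℝ) < n := by exact_mod_cast hn1
  rw [← div_le_iff₀ hn0]
  refine le_trans (le_of_eq ?_) hn
  ring

section

variable {Ω : Type*} [MeasurableSpace Ω] {P : Measure Ω} [IsProbabilityMeasure P]
  {a a' : ℝ} {X X' : ℕ → Ω → ℤ}

lemma growth_le_rpow (ha : -1 < a) (ha2 : a < 1 / 2) {n : ℕ} (hn : 1 ≤ n) :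
    growth a n / growth a 1 ≤ Real.exp 1 * (n : ℝ) ^ (max a 0) := by
  simpa using growth_div_le ha (le_max_left a 0) (le_max_right a 0)
    (max_le (by linarith) zero_le_one) le_rfl hn

/-- The upper half of the law of the iterated logarithm along a geometric subsequence. -/
lemma IsSignSequence.ae_eventually_abs_combo_le
    (hY : IsSignSequence P 2 (interleave X X') (interleave (drift a X) (drift a' X')))
    (hX : ∀ n ω, X n ω = 1 ∨ X n ω = -1) (hX' : ∀ n ω, X' n ω = 1 ∨ X' n ω = -1)
    (ha : -1 < a) (ha2 : a < 1 / 2) (ha' : -1 < a') (ha2' : a' < 1 / 2) {α β v : ℝ}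
    (hv : α ^ 2 * (1 / (1 - 2 * a)) + β ^ 2 * (1 / (1 - 2 * a')) < v) {ν : ℕ → ℕ} {c : ℝ}
    (hν : Tendsto ν atTop atTop) (hc : 0 < c)
    (hlog : ∀ᶠ k : ℕ in atTop, c * k ≤ Real.log (ν k)) :
    ∀ᵐ ω ∂P, ∀ᶠ k in atTop,
      |α * walk X (ν k) ω + β * walk X' (ν k) ω| ≤ Real.sqrt v * lilScale (ν k) := by
  obtain ⟨v₀, hv₀, hv₀'⟩ := exists_between hv
  obtain ⟨v₁, hv₁, hv₁'⟩ := exists_between hv₀'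
  have hvar0 : 0 ≤ α ^ 2 * (1 / (1 - 2 * a)) + β ^ 2 * (1 / (1 - 2 * a')) := by
    have h1 : 0 < 1 - 2 * a := by linarith
    have h2 : 0 < 1 - 2 * a' := by linarith
    positivity
  have hv₀0 : 0 < v₀ := by linarith
  have hv₁0 : 0 < v₁ := by linarith
  have hgap : 0 < Real.sqrt v - Real.sqrt v₁ := sub_pos.2 (Real.sqrt_lt_sqrt hv₁0.le hv₁')
  set b := max (max a 0) (max a' 0) with hb
  have hb2 : b < 1 / 2 := max_lt (max_lt ha2 (by norm_num)) (max_lt ha2' (by norm_num))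
  let E : ℕ → Set Ω := fun n => {ω | Real.sqrt v₁ * lilScale n ≤
    |∑ k ∈ Finset.Ico (2 * 1) (2 * n), innovCoef a a' α β n k *
      (interleave X X' k ω - interleave (drift a X) (drift a' X') k ω)|}
  have hE : ∀ᶠ n in atTop, P.real (E n) ≤
      2 * Real.exp (-(v₁ / v₀ * Real.log (Real.log n))) := by
    filter_upwards [eventually_ge_atTop 3,
      eventually_combo_blockVar_lt ha ha2 ha' ha2' hv₀] with n hn hvar
    have hn0 : (0 : ℝ) < n := by positivity
    refine (hY.measure_abs_ge_le (m := 2 * 1) (n := 2 * n) (by norm_num) (by omega)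
      (c := fun k _ => innovCoef a a' α β n k) (b := fun k => |innovCoef a a' α β n k|)
      (fun k => Past.const _) (fun k ω => le_rfl) (V := v₀ * n) (by positivity) ?_
      (mul_nonneg (Real.sqrt_nonneg _) (lilScale_nonneg n))).trans (le_of_eq ?_)
    · simp only [sq_abs]
      rw [sum_innovCoef_sq a a' α β (by omega)]
      exact hvar
    · rw [mul_pow, Real.sq_sqrt hv₁0.le, lilScale_sq hn]
      congr 3
      field_simp
  have hsum :=
    (summable_exp_neg_log_log (s := v₁ / v₀) hc ((one_lt_div hv₀0).2 hv₁) hlog).mul_left 2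
  filter_upwards [ae_eventually_notMem_of_summable hsum (hν.eventually hE)] with ω hω
  filter_upwards [hω, hν.eventually (eventually_rpow_le_lilScale hb2
    ((|α| + |β|) * Real.exp 1) hgap), hν.eventually (eventually_ge_atTop 1)] with k h1 h2 h3
  simp only [E, Set.mem_ofPred_eq, not_le] at h1
  have hwalk : ∀ {Z : ℕ → Ω → ℤ}, (∀ n ω, Z n ω = 1 ∨ Z n ω = -1) → |walk Z 1 ω| = 1 := by
    intro Z hZ
    rcases hZ 0 ω with h | h <;> simp [walk, h]
  have hone : (1 : ℝ) ≤ ν k := by exact_mod_cast h3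
  have hterm : ∀ {a₁ : ℝ} (γ : ℝ) {Z : ℕ → Ω → ℤ}, (∀ n ω, Z n ω = 1 ∨ Z n ω = -1) → -1 < a₁ →
      a₁ < 1 / 2 → max a₁ 0 ≤ b →
      |γ * (growth a₁ (ν k) / growth a₁ 1 * walk Z 1 ω)| ≤ |γ| * (Real.exp 1 * (ν k : ℝ) ^ b) := by
    intro a₁ γ Z hZ h h' hab
    rw [abs_mul, abs_mul, hwalk hZ, mul_one,
      abs_of_pos (div_pos (growth_pos h _) (growth_pos h _))]
    gcongr
    refine (growth_le_rpow h h' h3).trans ?_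
    gcongr
  rw [combo_eq ha ha' X X' α β h3]
  refine (abs_add_le _ _).trans ((add_le_add ((abs_add_le _ _).trans (add_le_add
    (hterm α hX ha ha2 (le_max_left _ _))
    (hterm β hX' ha' ha2' (le_max_right _ _)))) h1.le).trans ?_)
  nlinarith

/-- Fluctuations of the walk over short geometric blocks. -/
lemma IsSignSequence.ae_eventually_forall_abs_walk_sub_le
    (hY : IsSignSequence P 2 (interleave X X') (interleave (drift a X) (drift a' X')))
    (ha : -1 < a) (ha2 : a < 1 / 2) {ν : ℕ → ℕ} {c η : ℝ}
    (hν : Tendsto ν atTop atTop) (hmono : Monotone ν) (hc : 0 < c)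
    (hlog : ∀ᶠ k : ℕ in atTop, c * k ≤ Real.log (ν k)) (hη : 0 < η) (hη1 : η ≤ 1 / 4)
    (hratio : ∀ᶠ k : ℕ in atTop, (ν (k + 1) : ℝ) ≤ (1 + η) * ν k) :
    ∀ᵐ ω ∂P, ∀ᶠ k in atTop, ∀ n, ν k ≤ n → n ≤ ν (k + 1) →
      |walk X n ω - walk X (ν k) ω| ≤
        2 * η * |walk X (ν k) ω| + 2 * Real.sqrt (8 * η) * lilScale (ν k) := by
  let T : ℕ → ℕ → Ω → ℝ := fun m j ω => ∑ k ∈ Finset.Ico (2 * m) j,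
    interleave (fun i => growth a m / growth a (i + 1)) (fun _ => 0) k *
      (interleave X X' k ω - interleave (drift a X) (drift a' X') k ω)
  have hgrowth : ∀ {m n : ℕ}, 1 ≤ m → m ≤ n → (n : ℝ) ≤ (1 + η) * m →
      |growth a n / growth a m - 1| ≤ 2 * η := by
    intro m n hm hmn h
    refine (abs_growth_div_sub_one_le ha (by linarith) hm hmn h).trans ?_
    have := Real.abs_exp_sub_one_le (x := η) (by rw [abs_of_pos hη]; linarith)
    rw [abs_of_pos hη] at this
    exact (le_abs_self _).trans this
  let E : ℕ → Set Ω := fun k => {ω | ∃ j ≤ 2 * ν (k + 1),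
    Real.sqrt (8 * η) * lilScale (ν k) ≤ |T (ν k) j ω|}
  have hE : ∀ᶠ k in atTop, P.real (E k) ≤ 2 * Real.exp (-(2 * Real.log (Real.log (ν k)))) := by
    filter_upwards [hratio, hν.eventually (eventually_ge_atTop 3)] with k hk hk3
    have hm0 : (0 : ℝ) < ν k := by positivity
    have hle : ν k ≤ ν (k + 1) := hmono k.le_succ
    refine (hY.measure_exists_abs_ge_le (by omega) (by omega : 2 * ν k ≤ 2 * ν (k + 1)) _
      (V := 4 * (η * ν k)) (by positivity) ?_
      (mul_nonneg (Real.sqrt_nonneg _) (lilScale_nonneg _))).trans (le_of_eq ?_)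
    · rw [sum_Ico_two_mul _ hle]
      simp only [interleave_even, interleave_odd]
      calc _ ≤ ∑ i ∈ Finset.Ico (ν k) (ν (k + 1)), (4 : ℝ) := by
            refine Finset.sum_le_sum fun i hi => ?_
            obtain ⟨hi1, hi2⟩ := Finset.mem_Ico.1 hi
            have hi3 : ((i + 1 : ℕ) : ℝ) ≤ ν (k + 1) := by exact_mod_cast hi2
            have h1 := (_root_.abs_le.1
              (hgrowth (n := i + 1) (by omega) (by omega) (hi3.trans hk))).1
            have h2 : 1 / 2 ≤ growth a (i + 1) / growth a (ν k) := by linarith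
            have h3 : growth a (ν k) / growth a (i + 1) ≤ 2 := by
              rw [← inv_div]
              calc _ ≤ (1 / 2 : ℝ)⁻¹ := by gcongr
                _ = 2 := by norm_num
            have h4 := div_pos (growth_pos ha (ν k)) (growth_pos ha (i + 1))
            nlinarith
        _ = 4 * ((ν (k + 1) : ℝ) - ν k) := by
            rw [Finset.sum_const, Nat.card_Ico, nsmul_eq_mul, Nat.cast_sub hle]; ring
        _ ≤ _ := by linarith
    · rw [mul_pow, Real.sq_sqrt (by positivity), lilScale_sq hk3]
      congr 3
      field_simp
      ring
  have hsum := (summable_exp_neg_log_log (s := 2) hc (by norm_num) hlog).mul_left 2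
  filter_upwards [ae_eventually_notMem_of_summable hsum hE] with ω hω
  filter_upwards [hω, hratio, hν.eventually (eventually_ge_atTop 1)] with k h1 hk hk1 n hn hn'
  simp only [E, Set.mem_ofPred_eq, not_exists, not_and, not_le] at h1
  have hT := h1 (2 * n) (by omega)
  have hn3 : (n : ℝ) ≤ ν (k + 1) := by exact_mod_cast hn'
  have hg := hgrowth hk1 hn (hn3.trans hk)
  have hsub : walk X n ω - walk X (ν k) ω =
      (growth a n / growth a (ν k) - 1) * walk X (ν k) ω +
        growth a n / growth a (ν k) * T (ν k) (2 * n) ω := by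
    rw [walk_eq_growth_mul_add_sum ha X hn]
    simp only [T]
    rw [sum_Ico_two_mul _ hn, Finset.mul_sum]
    simp only [interleave_even, interleave_odd, zero_mul, add_zero, ← mul_assoc,
      div_mul_div_cancel₀ (growth_pos ha (ν k)).ne']
    ring
  have hg2 : |growth a n / growth a (ν k)| ≤ 2 := by
    rw [abs_of_pos (div_pos (growth_pos ha n) (growth_pos ha (ν k)))]
    linarith [(_root_.abs_le.1 hg).2]
  rw [hsub]
  refine (abs_add_le _ _).trans (add_le_add ?_ ?_)
  · rw [abs_mul]
    gcongr
  · rw [abs_mul, mul_assoc]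
    exact mul_le_mul hg2 hT.le (abs_nonneg _) zero_le_two

end

lemma exists_mem_block {ν : ℕ → ℕ} (hν : Tendsto ν atTop atTop) {k₁ n : ℕ} (hn : ν k₁ ≤ n) :
    ∃ k ≥ k₁, ν k ≤ n ∧ n ≤ ν (k + 1) := by
  have hex : ∃ j, n < ν (k₁ + j) := by
    obtain ⟨K, hK⟩ := (hν.eventually_gt_atTop n).exists_forall_of_atTop
    exact ⟨K, hK _ (by omega)⟩
  have h0 : Nat.find hex ≠ 0 := by
    intro h
    have := Nat.find_spec hex
    rw [h] at this
    exact absurd this (not_lt.2 hn)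
  obtain ⟨j, hj⟩ := Nat.exists_eq_succ_of_ne_zero h0
  refine ⟨k₁ + j, by omega, not_lt.1 (Nat.find_min hex (by omega)), ?_⟩
  have := Nat.find_spec hex
  rw [hj] at this
  exact this.le

lemma floor_pow_geometric {η : ℝ} (hη : 0 < η) :
    ∃ ν : ℕ → ℕ, ∃ c : ℝ, Tendsto ν atTop atTop ∧ Monotone ν ∧ 0 < c ∧
      (∀ᶠ k : ℕ in atTop, c * k ≤ Real.log (ν k)) ∧
      ∀ᶠ k : ℕ in atTop, (ν (k + 1) : ℝ) ≤ (1 + η) * ν k := by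
  set θ : ℝ := 1 + η / 2 with hθ
  have hθ1 : 1 < θ := by linarith
  have hpow : Tendsto (fun k : ℕ => θ ^ k) atTop atTop := tendsto_pow_atTop_atTop_of_one_lt hθ1
  have hν : Tendsto (fun k : ℕ => ⌊θ ^ k⌋₊) atTop atTop := tendsto_nat_floor_atTop.comp hpow
  have hlogθ : 0 < Real.log θ := Real.log_pos hθ1
  refine ⟨fun k => ⌊θ ^ k⌋₊, Real.log θ / 2, hν, ?_, by positivity, ?_, ?_⟩
  · intro k l hkl
    exact Nat.floor_mono (pow_le_pow_right₀ hθ1.le hkl)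
  · filter_upwards [(tendsto_natCast_atTop_atTop (R := ℝ)).eventually_ge_atTop
      (2 * Real.log 2 / Real.log θ)] with k hk
    have h1 : 1 ≤ θ ^ k := one_le_pow₀ hθ1.le
    have h2 : (1 : ℝ) ≤ ⌊θ ^ k⌋₊ := by exact_mod_cast Nat.floor_pos.2 h1
    have h3 := Nat.lt_floor_add_one (θ ^ k)
    have h4 : Real.log (θ ^ k / 2) ≤ Real.log ⌊θ ^ k⌋₊ :=
      Real.log_le_log (by positivity) (by linarith)
    rw [Real.log_div (by positivity) two_ne_zero, Real.log_pow] at h4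
    rw [div_le_iff₀ hlogθ] at hk
    linarith
  · filter_upwards [(tendsto_natCast_atTop_atTop (R := ℝ)).comp hν
      |>.eventually_ge_atTop (θ / (η / 2))] with k hk
    have hk' : θ ≤ ⌊θ ^ k⌋₊ * (η / 2) := (div_le_iff₀ (by positivity)).1 hk
    have h1 : (⌊θ ^ (k + 1)⌋₊ : ℝ) ≤ θ ^ (k + 1) := Nat.floor_le (by positivity)
    have h3 := Nat.lt_floor_add_one (θ ^ k)
    have h4 : θ ^ (k + 1) ≤ θ * (⌊θ ^ k⌋₊ + 1) := by
      rw [pow_succ, mul_comm]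
      gcongr
    have h5 : θ * (⌊θ ^ k⌋₊ + 1) ≤ (1 + η) * ⌊θ ^ k⌋₊ := by
      rw [hθ] at hk' ⊢
      linarith
    linarith

/-- The upper half of the law of the iterated logarithm for the difference of two walks. -/
lemma ae_eventually_abs_walk_sub_walk_le {Ω : Type*} [MeasurableSpace Ω] {P : Measure Ω}
    [IsProbabilityMeasure P] {X X' : ℕ → Ω → ℤ} {a a' : ℝ}
    (hY : IsSignSequence P 2 (interleave X X') (interleave (drift a X) (drift a' X')))
    (hY' : IsSignSequence P 2 (interleave X' X) (interleave (drift a' X') (drift a X)))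
    (hX : ∀ n ω, X n ω = 1 ∨ X n ω = -1) (hX' : ∀ n ω, X' n ω = 1 ∨ X' n ω = -1)
    (ha : -1 < a) (ha2 : a < 1 / 2) (ha' : -1 < a') (ha2' : a' < 1 / 2) {τ : ℝ}
    (hτ : Real.sqrt (1 / (1 - 2 * a) + 1 / (1 - 2 * a')) < τ) :
    ∀ᵐ ω ∂P, ∀ᶠ n in atTop, |walk X n ω - walk X' n ω| ≤ τ * lilScale n := by
  have hd : 0 < 1 / (1 - 2 * a) := by have : 0 < 1 - 2 * a := by linarith
                                      positivity
  have hd' : 0 < 1 / (1 - 2 * a') := by have : 0 < 1 - 2 * a' := by linarith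
                                        positivity
  obtain ⟨τ₁, hτ₁, hτ₁'⟩ := exists_between hτ
  have hτ₁0 : 0 < τ₁ := (Real.sqrt_nonneg _).trans_lt hτ₁
  set C : ℝ := Real.sqrt (1 / (1 - 2 * a) + 1 / (1 - 2 * a') + 1)
  have hlim : Tendsto (fun η : ℝ => τ₁ + 4 * η * C + 4 * Real.sqrt (8 * η)) (nhds 0) (nhds τ₁) := by
    have : Continuous (fun η : ℝ => τ₁ + 4 * η * C + 4 * Real.sqrt (8 * η)) := by fun_prop
    simpa using this.tendsto 0
  obtain ⟨η, hη, hη0, hη1⟩ := ((hlim.mono_left nhdsWithin_le_nhds).eventually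
    (gt_mem_nhds hτ₁') |>.and (Ioc_mem_nhdsGT (show (0 : ℝ) < 1 / 4 by norm_num))).exists
  obtain ⟨ν, c, hν, hmono, hc, hlog, hratio⟩ := floor_pow_geometric hη0
  have h₁ := hY.ae_eventually_abs_combo_le hX hX' ha ha2 ha' ha2' (α := 1) (β := -1) (v := τ₁ ^ 2)
    (by have := (Real.sqrt_lt' hτ₁0).1 hτ₁; norm_num at this ⊢; linarith) hν hc hlog
  have h₂ := hY.ae_eventually_abs_combo_le hX hX' ha ha2 ha' ha2' (α := 1) (β := 0)
    (v := 1 / (1 - 2 * a) + 1 / (1 - 2 * a') + 1) (by linarith) hν hc hlog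
  have h₃ := hY.ae_eventually_abs_combo_le hX hX' ha ha2 ha' ha2' (α := 0) (β := 1)
    (v := 1 / (1 - 2 * a) + 1 / (1 - 2 * a') + 1) (by linarith) hν hc hlog
  filter_upwards [h₁, h₂, h₃,
    hY.ae_eventually_forall_abs_walk_sub_le ha ha2 hν hmono hc hlog hη0 hη1 hratio,
    hY'.ae_eventually_forall_abs_walk_sub_le ha' ha2' hν hmono hc hlog hη0 hη1 hratio]
    with ω h₁ h₂ h₃ h₄ h₅
  obtain ⟨k₁, hk₁⟩ := (h₁.and (h₂.and (h₃.and (h₄.and (h₅.and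
    (hν.eventually_ge_atTop 3)))))).exists_forall_of_atTop
  filter_upwards [eventually_ge_atTop (ν k₁)] with n hn
  obtain ⟨k, hk, hkn, hnk⟩ := exists_mem_block hν hn
  obtain ⟨g₁, g₂, g₃, g₄, g₅, g₆⟩ := hk₁ k hk
  have g₄ := g₄ n hkn hnk
  have g₅ := g₅ n hkn hnk
  rw [Real.sqrt_sq hτ₁0.le, one_mul, neg_one_mul, ← sub_eq_add_neg] at g₁
  rw [one_mul, zero_mul, add_zero] at g₂
  rw [one_mul, zero_mul, zero_add] at g₃
  have hscale := lilScale_mono g₆ hkn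
  have hL := lilScale_nonneg (ν k)
  have htri : |walk X n ω - walk X' n ω| ≤ |walk X (ν k) ω - walk X' (ν k) ω| +
      |walk X n ω - walk X (ν k) ω| + |walk X' n ω - walk X' (ν k) ω| := by
    rw [show walk X n ω - walk X' n ω = (walk X (ν k) ω - walk X' (ν k) ω) +
      (walk X n ω - walk X (ν k) ω) - (walk X' n ω - walk X' (ν k) ω) by ring]
    exact (abs_sub _ _).trans (add_le_add (abs_add_le _ _) le_rfl)
  have e₂ : 2 * η * |walk X (ν k) ω| ≤ 2 * η * (C * lilScale (ν k)) := by gcongr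
  have e₃ : 2 * η * |walk X' (ν k) ω| ≤ 2 * η * (C * lilScale (ν k)) := by gcongr
  calc _ ≤ (τ₁ + 4 * η * C + 4 * Real.sqrt (8 * η)) * lilScale (ν k) := by linarith
    _ ≤ τ * lilScale (ν k) := by gcongr
    _ ≤ τ * lilScale n := by
      have : 0 ≤ τ := by linarith
      gcongr

lemma tendsto_log_mul_rpow_neg {s : ℝ} (hs : 0 < s) :
    Tendsto (fun n : ℕ => Real.log n * (n : ℝ) ^ (-s)) atTop (nhds 0) := by
  refine ((isLittleO_log_rpow_atTop hs).tendsto_div_nhds_zero.comp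
    tendsto_natCast_atTop_atTop).congr fun n => ?_
  simp only [Function.comp_apply]
  rw [Real.rpow_neg n.cast_nonneg, div_eq_mul_inv]

lemma log_log_le_log {n : ℕ} (hn : 3 ≤ n) : Real.log (Real.log n) ≤ Real.log n := by
  have := Real.log_le_sub_one_of_pos (lt_of_lt_of_le one_pos (one_le_log_natCast hn))
  linarith

lemma eventually_rpow_mul_log_log_le {b : ℝ} (hb : b < 1 / 2) (C : ℝ) (hC : 0 ≤ C) {ε : ℝ}
    (hε : 0 < ε) :
    ∀ᶠ n : ℕ in atTop, C * ((n : ℝ) ^ b) ^ 2 * Real.log (Real.log n) ≤ ε * n := by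
  have hlim := (tendsto_log_mul_rpow_neg (by linarith : 0 < 1 - 2 * b)).const_mul C
  rw [mul_zero] at hlim
  filter_upwards [hlim.eventually_le_const hε, eventually_ge_atTop 3] with n h1 hn
  have hn0 : (0 : ℝ) < n := by positivity
  have hpow : ((n : ℝ) ^ b) ^ 2 = (n : ℝ) ^ (-(1 - 2 * b)) * n := by
    rw [← Real.rpow_mul_natCast hn0.le, ← Real.rpow_add_one hn0.ne']
    congr 1
    push_cast
    ring
  calc C * ((n : ℝ) ^ b) ^ 2 * Real.log (Real.log n) ≤ C * ((n : ℝ) ^ b) ^ 2 * Real.log n := by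
        exact mul_le_mul_of_nonneg_left (log_log_le_log hn) (by positivity)
    _ = C * (Real.log n * (n : ℝ) ^ (-(1 - 2 * b))) * n := by rw [hpow]; ring
    _ ≤ ε * n := by gcongr

lemma eventually_mul_exp_neg_le {c s : ℝ} (hc : 0 < c) (hs : s ≤ 8) :
    ∀ᶠ n : ℕ in atTop, 4 * n * Real.exp (-(c * n)) ≤
      Real.exp (-(s * Real.log (Real.log n))) := by
  have hlim : Tendsto (fun n : ℕ => 4 / c ^ 9 * ((c * n) ^ 9 * Real.exp (-(c * n)))) atTop
      (nhds 0) := by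
    simpa using ((Real.tendsto_pow_mul_exp_neg_atTop_nhds_zero 9).comp
      (tendsto_natCast_atTop_atTop.const_mul_atTop hc)).const_mul (4 / c ^ 9)
  filter_upwards [hlim.eventually_le_const one_pos, eventually_ge_atTop 3] with n h1 hn
  have hn0 : (0 : ℝ) < n := by positivity
  have hl := Real.log_nonneg (one_le_log_natCast hn)
  have hll := log_log_le_log hn
  have h2 : Real.exp (-(8 * Real.log n)) ≤ Real.exp (-(s * Real.log (Real.log n))) := by
    refine Real.exp_le_exp.2 (neg_le_neg ?_)
    nlinarith
  refine le_trans ?_ h2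
  have h8 : Real.exp (-(8 * Real.log n)) = 1 / (n : ℝ) ^ 8 := by
    rw [Real.exp_neg, show (8 : ℝ) * Real.log n = ((8 : ℕ) : ℝ) * Real.log n by norm_num,
      Real.exp_nat_mul, Real.exp_log hn0, one_div]
  rw [h8, le_div_iff₀ (by positivity)]
  refine le_trans (le_of_eq ?_) h1
  field_simp

lemma blockVar_le_blockVar_one (a : ℝ) {m : ℕ} (hm : 1 ≤ m) (n : ℕ) :
    blockVar a m n ≤ blockVar a 1 n :=
  Finset.sum_le_sum_of_subset_of_nonneg (Finset.Ico_subset_Ico_left hm) fun _ _ _ => sq_nonneg _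

/-- Over long geometric blocks the accumulated variance is asymptotically maximal. -/
lemma eventually_blockVar_pow_ge {a v : ℝ} (ha : -1 < a) (ha2 : a < 1 / 2)
    (hv : v < 1 / (1 - 2 * a)) : ∀ᶠ K : ℕ in atTop, ∀ᶠ k : ℕ in atTop,
      v * ((K ^ (k + 1) : ℕ) : ℝ) ≤ blockVar a (K ^ k) (K ^ (k + 1)) := by
  set b := max a 0 with hb
  have hb2 : b < 1 / 2 := max_lt ha2 (by norm_num)
  obtain ⟨v₁, hv₁, hv₁'⟩ := exists_between hv
  have hlim := tendsto_blockVar_div ha ha2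
  set u := 1 / (1 - 2 * a) + 1 with hu
  have hu0 : 0 < u := by
    have : 0 < 1 - 2 * a := by linarith
    positivity
  have hKlim : Tendsto (fun K : ℕ => Real.exp 1 ^ 2 * u * (K : ℝ) ^ (-(1 - 2 * b))) atTop
      (nhds 0) := by
    have := ((tendsto_rpow_neg_atTop (by linarith : 0 < 1 - 2 * b)).comp
      tendsto_natCast_atTop_atTop).const_mul (Real.exp 1 ^ 2 * u)
    rwa [mul_zero] at this
  filter_upwards [hKlim.eventually_le_const (sub_pos.2 hv₁), eventually_ge_atTop 2] with K hK hK2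
  have hK0 : (0 : ℝ) < K := by positivity
  have hpow : Tendsto (fun k : ℕ => K ^ k) atTop atTop :=
    tendsto_pow_atTop_atTop_of_one_lt (by omega)
  filter_upwards [hpow.eventually (hlim.eventually_le_const (show _ < u by rw [hu]; linarith)),
    (hpow.comp (tendsto_add_atTop_nat 1)).eventually (hlim.eventually_const_le hv₁')] with k h1 h2
  have hm : 1 ≤ K ^ k := Nat.one_le_pow _ _ (by omega)
  have hmN : K ^ k ≤ K ^ (k + 1) := Nat.pow_le_pow_right (by omega) k.le_succ
  have hm0 : (0 : ℝ) < ((K ^ k : ℕ) : ℝ) := by exact_mod_cast hm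
  have hN : ((K ^ (k + 1) : ℕ) : ℝ) = ((K ^ k : ℕ) : ℝ) * K := by push_cast; ring
  have hN0 : (0 : ℝ) < ((K ^ (k + 1) : ℕ) : ℝ) := by rw [hN]; positivity
  rw [div_le_iff₀ hm0] at h1
  simp only [Function.comp_apply] at h2
  rw [le_div_iff₀ hN0] at h2
  have hg : growth a (K ^ (k + 1)) / growth a (K ^ k) ≤ Real.exp 1 * (K : ℝ) ^ b := by
    have := growth_div_le ha (le_max_left a 0) (le_max_right a 0)
      (max_le (by linarith) zero_le_one) hm hmN
    rwa [hN, mul_div_cancel_left₀ _ hm0.ne'] at this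
  have hg0 := div_pos (growth_pos ha (K ^ (k + 1))) (growth_pos ha (K ^ k))
  have hsq : (growth a (K ^ (k + 1)) / growth a (K ^ k)) ^ 2 * blockVar a 1 (K ^ k) ≤
      (v₁ - v) * ((K ^ (k + 1) : ℕ) : ℝ) := by
    calc _ ≤ (Real.exp 1 * (K : ℝ) ^ b) ^ 2 * (u * ((K ^ k : ℕ) : ℝ)) := by
          gcongr
          exact blockVar_nonneg _ _ _
      _ = Real.exp 1 ^ 2 * u * (K : ℝ) ^ (-(1 - 2 * b)) * ((K ^ (k + 1) : ℕ) : ℝ) := by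
          have : ((K : ℝ) ^ b) ^ 2 = (K : ℝ) ^ (-(1 - 2 * b)) * K := by
            rw [← Real.rpow_mul_natCast hK0.le, ← Real.rpow_add_one hK0.ne']
            congr 1
            push_cast
            ring
          rw [mul_pow, this, hN]
          ring
      _ ≤ _ := by gcongr
  rw [blockVar_eq_sub ha hm hmN]
  linarith

lemma abs_walk_le_of_start {Ω : Type*} {X : ℕ → Ω → ℤ} {a : ℝ}
    (ha : -1 < a) (ha2 : a < 1 / 2) {γ : ℝ} {m j : ℕ} (hm : 1 ≤ m)
    (hmj : m ≤ j) {ω : Ω} (hstart : |walk X m ω| ≤ γ / 16 * m) :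
    |growth a j / growth a m * walk X m ω| ≤ γ / 4 * j := by
  have hm0 : (0 : ℝ) < m := by exact_mod_cast hm
  have hj0 : (m : ℝ) ≤ j := by exact_mod_cast hmj
  have hb1 : max a 0 ≤ 1 := max_le (by linarith) zero_le_one
  have hg := growth_div_le ha (le_max_left a 0) (le_max_right a 0) hb1 hm hmj
  have hone : 1 ≤ (j : ℝ) / m := (one_le_div hm0).2 hj0
  have hpow : ((j : ℝ) / m) ^ (max a 0) ≤ j / m := by
    simpa using Real.rpow_le_rpow_of_exponent_le hone hb1
  have he : Real.exp 1 ≤ 4 := by have := Real.exp_one_lt_d9; linarith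
  have hγ : 0 ≤ γ / 16 * m := (abs_nonneg _).trans hstart
  rw [abs_mul, abs_of_pos (div_pos (growth_pos ha j) (growth_pos ha m))]
  calc _ ≤ (4 * ((j : ℝ) / m)) * (γ / 16 * m) := by
        refine mul_le_mul (hg.trans ?_) hstart (abs_nonneg _) (by positivity)
        gcongr
    _ = γ / 4 * j := by field_simp; ring

lemma abs_drift_le_of_abs_walk_le {Ω : Type*} {X : ℕ → Ω → ℤ} {a : ℝ}
    (ha : -1 < a) (ha2 : a < 1 / 2) {γ : ℝ} {j : ℕ} (hj : 1 ≤ j)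
    {ω : Ω} (h : |walk X j ω| ≤ γ * j) : |drift a X j ω| ≤ γ := by
  have hj0 : (0 : ℝ) < j := by exact_mod_cast hj
  rw [drift, abs_div, Nat.abs_cast, abs_mul, div_le_iff₀ hj0]
  refine le_trans ?_ h
  exact mul_le_of_le_one_left (abs_nonneg _) (abs_le.2 ⟨by linarith, by linarith⟩)

section

variable {Ω : Type*} [MeasurableSpace Ω] {P : Measure Ω} [IsProbabilityMeasure P]
  {a a' : ℝ} {X X' : ℕ → Ω → ℤ}

/-- Starting from a small position, the drifts stay small over a whole block, up to an
exponentially small probability. -/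
lemma IsSignSequence.setIntegral_drift_large_le
    (hY : IsSignSequence P 2 (interleave X X') (interleave (drift a X) (drift a' X')))
    (ha : -1 < a) (ha2 : a < 1 / 2) (ha' : -1 < a') (ha2' : a' < 1 / 2) {m N : ℕ} (hm : 1 ≤ m)
    {v γ : ℝ} (hv0 : 0 < v)
    (hv : ∀ j ≥ m, blockVar a 1 j ≤ v * j ∧ blockVar a' 1 j ≤ v * j) (hγ : 0 < γ)
    {f : Ω → ℝ} (hf : Past (interleave X X') (2 * m) f) (hf0 : ∀ ω, 0 ≤ f ω)
    (hfG : ∀ ω, f ω ≠ 0 → |walk X m ω| ≤ γ / 16 * m ∧ |walk X' m ω| ≤ γ / 16 * m)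
    {c : ℕ → ℝ} {V : ℝ} (hV : ∑ k ∈ Finset.Ico (2 * m) (2 * N), c k ^ 2 = V) :
    ∫ ω in {ω | γ ^ 2 / 4 * V < ∑ k ∈ Finset.Ico (2 * m) (2 * N),
        c k ^ 2 * interleave (drift a X) (drift a' X') k ω ^ 2}, f ω ∂P ≤
      4 * N * Real.exp (-(γ ^ 2 / (32 * v) * m)) * ∫ ω, f ω ∂P := by
  have hm0 : (0 : ℝ) < m := by exact_mod_cast hm
  have hI : 0 ≤ ∫ ω, f ω ∂P := integral_nonneg hf0
  have hfi : Integrable f P := hf.integrable hY.measurable hY.sign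
  let T : ℝ → ℝ → ℕ → Ω → ℝ := fun α β j ω => ∑ k ∈ Finset.Ico (2 * m) (2 * j),
    innovCoef a a' α β j k *
      (interleave X X' k ω - interleave (drift a X) (drift a' X') k ω)
  let B : ℝ → ℝ → ℕ → Set Ω := fun α β j => {ω | γ / 4 * j ≤ |T α β j ω|}
  have hTp : ∀ α β j, Past (interleave X X') (2 * j) (T α β j) := fun α β j =>
    hY.past_sum (c := fun k _ => innovCoef a a' α β j k) (fun k => Past.const _) _
      fun k hk => (Finset.mem_Ico.1 hk).2
  have hBm : ∀ α β j, MeasurableSet (B α β j) := fun α β j =>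
    measurableSet_le measurable_const ((hTp α β j).measurable hY.measurable).abs
  have hB : ∀ α β : ℝ, (α ^ 2 + β ^ 2 = 1) → ∀ j ∈ Finset.Ico m N,
      ∫ ω in B α β j, f ω ∂P ≤ 2 * Real.exp (-(γ ^ 2 / (32 * v) * m)) * ∫ ω, f ω ∂P := by
    intro α β hαβ j hj
    have hmj := (Finset.mem_Ico.1 hj).1
    have hj0 : (m : ℝ) ≤ j := by exact_mod_cast hmj
    have hj00 : (0 : ℝ) < j := hm0.trans_le hj0
    refine (hY.setIntegral_abs_ge_le (by omega) (by omega : 2 * m ≤ 2 * j) hf hf0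
      (c := fun k _ => innovCoef a a' α β j k) (b := fun k => |innovCoef a a' α β j k|)
      (fun k => Past.const _) (fun k ω => le_rfl) (V := v * j) (by positivity) ?_
      (by positivity)).trans ?_
    · simp only [sq_abs]
      rw [sum_innovCoef_sq a a' α β hmj]
      have h1 := (blockVar_le_blockVar_one a hm j).trans (hv j hmj).1
      have h2 := (blockVar_le_blockVar_one a' hm j).trans (hv j hmj).2
      calc _ ≤ α ^ 2 * (v * j) + β ^ 2 * (v * j) := by gcongr
        _ = v * j := by rw [← add_mul, hαβ, one_mul]
    · have : (γ / 4 * j) ^ 2 / (2 * (v * j)) = γ ^ 2 / (32 * v) * j := by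
        field_simp
        norm_num
      rw [this]
      gcongr
  have hRm : MeasurableSet {ω | γ ^ 2 / 4 * V < ∑ k ∈ Finset.Ico (2 * m) (2 * N),
      c k ^ 2 * interleave (drift a X) (drift a' X') k ω ^ 2} := by
    refine measurableSet_lt measurable_const (Finset.measurable_sum _ fun k _ => ?_)
    exact (((hY.past k).measurable hY.measurable).pow_const 2).const_mul _
  have hpt : ∀ ω, {ω | γ ^ 2 / 4 * V < ∑ k ∈ Finset.Ico (2 * m) (2 * N),
      c k ^ 2 * interleave (drift a X) (drift a' X') k ω ^ 2}.indicator f ω ≤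
      ∑ j ∈ Finset.Ico m N, ((B 1 0 j).indicator f ω + (B 0 1 j).indicator f ω) := by
    intro ω
    have hnn : ∀ A : Set Ω, 0 ≤ A.indicator f ω := fun A =>
      Set.indicator_nonneg (fun ω _ => hf0 ω) ω
    have hterm : ∀ j ∈ Finset.Ico m N, 0 ≤ (B 1 0 j).indicator f ω + (B 0 1 j).indicator f ω :=
      fun j _ => add_nonneg (hnn _) (hnn _)
    by_cases hωR : ω ∈ {ω | γ ^ 2 / 4 * V < ∑ k ∈ Finset.Ico (2 * m) (2 * N),
      c k ^ 2 * interleave (drift a X) (drift a' X') k ω ^ 2}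
    swap
    · rw [Set.indicator_of_notMem hωR]
      exact Finset.sum_nonneg hterm
    by_cases hfω : f ω = 0
    · rw [Set.indicator_of_mem hωR, hfω]
      exact Finset.sum_nonneg hterm
    obtain ⟨hs, hs'⟩ := hfG ω hfω
    have hex : ∃ j ∈ Finset.Ico m N, ω ∈ B 1 0 j ∨ ω ∈ B 0 1 j := by
      by_contra! hno
      rw [Set.mem_ofPred_eq] at hωR
      refine absurd hωR (not_lt.2 ?_)
      rw [← hV, Finset.mul_sum]
      refine Finset.sum_le_sum fun k hk => ?_
      obtain ⟨hk1, hk2⟩ := Finset.mem_Ico.1 hk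
      have hμ : |interleave (drift a X) (drift a' X') k ω| ≤ γ / 2 := by
        have hj : k / 2 ∈ Finset.Ico m N := Finset.mem_Ico.2 ⟨by omega, by omega⟩
        have hmj := (Finset.mem_Ico.1 hj).1
        obtain ⟨hn1, hn2⟩ := hno _ hj
        simp only [B, Set.mem_ofPred_eq, not_le] at hn1 hn2
        have e1 := combo_eq ha ha' X X' 1 0 hmj ω
        have e2 := combo_eq ha ha' X X' 0 1 hmj ω
        simp only [one_mul, zero_mul, add_zero, zero_add] at e1 e2
        have b1 := abs_walk_le_of_start ha ha2 hm hmj hs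
        have b2 := abs_walk_le_of_start ha' ha2' hm hmj hs'
        rcases Nat.even_or_odd' k with ⟨i, rfl | rfl⟩
        · rw [show 2 * i / 2 = i by omega] at *
          rw [interleave_even]
          refine abs_drift_le_of_abs_walk_le ha ha2 (by omega) ?_
          rw [e1]
          refine (abs_add_le _ _).trans ((add_le_add b1 hn1.le).trans (le_of_eq (by ring)))
        · rw [show (2 * i + 1) / 2 = i by omega] at *
          rw [interleave_odd]
          refine abs_drift_le_of_abs_walk_le ha' ha2' (by omega) ?_
          rw [e2]
          refine (abs_add_le _ _).trans ((add_le_add b2 hn2.le).trans (le_of_eq (by ring)))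
      have hsq : interleave (drift a X) (drift a' X') k ω ^ 2 ≤ γ ^ 2 / 4 := by
        rw [← sq_abs]
        nlinarith [abs_nonneg (interleave (drift a X) (drift a' X') k ω)]
      nlinarith [sq_nonneg (c k)]
    obtain ⟨j, hj, hjB⟩ := hex
    rw [Set.indicator_of_mem hωR]
    refine le_trans ?_ (Finset.single_le_sum hterm hj)
    rcases hjB with h | h
    · rw [Set.indicator_of_mem h]
      linarith [hnn (B 0 1 j)]
    · rw [Set.indicator_of_mem h]
      linarith [hnn (B 1 0 j)]
  rw [← integral_indicator hRm]
  refine (integral_mono (hfi.indicator hRm) (integrable_finsetSum _ fun j _ =>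
    (hfi.indicator (hBm 1 0 j)).add (hfi.indicator (hBm 0 1 j))) hpt).trans ?_
  rw [integral_finsetSum _ fun j _ => by
    exact (hfi.indicator (hBm 1 0 j)).add (hfi.indicator (hBm 0 1 j))]
  calc _ ≤ ∑ j ∈ Finset.Ico m N,
        4 * (Real.exp (-(γ ^ 2 / (32 * v) * m)) * ∫ ω, f ω ∂P) := by
        refine Finset.sum_le_sum fun j hj => ?_
        rw [integral_add' (hfi.indicator (hBm 1 0 j)) (hfi.indicator (hBm 0 1 j)),
          integral_indicator (hBm 1 0 j), integral_indicator (hBm 0 1 j)]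
        have h1 := hB 1 0 (by norm_num) j hj
        have h2 := hB 0 1 (by norm_num) j hj
        linarith
    _ ≤ ∑ j ∈ Finset.range N,
        4 * (Real.exp (-(γ ^ 2 / (32 * v) * m)) * ∫ ω, f ω ∂P) := by
        refine Finset.sum_le_sum_of_subset_of_nonneg ?_ fun _ _ _ => by positivity
        intro j hj
        exact Finset.mem_range.2 (Finset.mem_Ico.1 hj).2
    _ = _ := by
        rw [Finset.sum_const, Finset.card_range, nsmul_eq_mul]
        ring

end

lemma abs_innovCoef_le {a a' b : ℝ} (ha : -1 < a) (ha' : -1 < a') (hab : a ≤ b) (hab' : a' ≤ b)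
    (hb0 : 0 ≤ b) (hb1 : b ≤ 1) {N k : ℕ} (hk : k < 2 * N) :
    |innovCoef a a' 1 (-1) N k| ≤ Real.exp 1 * (N : ℝ) ^ b := by
  have key : ∀ {a : ℝ}, -1 < a → a ≤ b → ∀ i < N,
      |growth a N / growth a (i + 1)| ≤ Real.exp 1 * (N : ℝ) ^ b := by
    intro a ha hab i hi
    rw [abs_of_pos (div_pos (growth_pos ha _) (growth_pos ha _))]
    refine (growth_div_le ha hab hb0 hb1 (by omega : 1 ≤ i + 1) hi).trans ?_
    gcongr
    refine div_le_self N.cast_nonneg ?_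
    push_cast
    linarith [(i.cast_nonneg : (0 : ℝ) ≤ i)]
  rcases Nat.even_or_odd' k with ⟨i, rfl | rfl⟩
  · rw [innovCoef, interleave_even, one_mul]
    exact key ha hab i (by omega)
  · rw [innovCoef, interleave_odd, neg_one_mul, abs_neg]
    exact key ha' hab' i (by omega)

section

variable {Ω : Type*} [MeasurableSpace Ω] {P : Measure Ω} [IsProbabilityMeasure P]
  {a a' : ℝ} {X X' : ℕ → Ω → ℤ}

set_option maxHeartbeats 800000 in
/-- On a geometric block, conditionally on a moderate past, the innovations are of the order of the
iterated logarithm with a non-summable probability. -/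
lemma IsSignSequence.eventually_le_measureReal_block
    (hY : IsSignSequence P 2 (interleave X X') (interleave (drift a X) (drift a' X')))
    (ha : -1 < a) (ha2 : a < 1 / 2) (ha' : -1 < a') (ha2' : a' < 1 / 2) {K : ℕ} (hK : 2 ≤ K)
    {κ v₀ : ℝ} (hκ0 : 0 < κ) (hκ1 : κ < 1) (hv₀ : 0 < v₀)
    (hV : ∀ᶠ k : ℕ in atTop, v₀ * ((K ^ (k + 1) : ℕ) : ℝ) ≤
      blockVar a (K ^ k) (K ^ (k + 1)) + blockVar a' (K ^ k) (K ^ (k + 1))) :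
    ∀ᶠ k : ℕ in atTop, ∀ C : Set Ω, Past (interleave X X') (2 * K ^ k) (· ∈ C) →
      C ⊆ {ω | |walk X (K ^ k) ω| ≤ κ / 64 * ((K ^ k : ℕ) : ℝ) ∧
        |walk X' (K ^ k) ω| ≤ κ / 64 * ((K ^ k : ℕ) : ℝ)} →
      1 / (2 * Real.log K) * (1 / ((k : ℝ) + 1)) * P.real C ≤
        P.real (C ∩ {ω | (1 - κ / 4) * (Real.sqrt ((1 - κ) * v₀) * lilScale (K ^ (k + 1))) ≤
          ∑ i ∈ Finset.Ico (2 * K ^ k) (2 * K ^ (k + 1)),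
            innovCoef a a' 1 (-1) (K ^ (k + 1)) i *
              (interleave X X' i ω - interleave (drift a X) (drift a' X') i ω)}) := by
  set γ := κ / 4 with hγ
  have hγ0 : 0 < γ := by positivity
  obtain ⟨θ₀, hθ₀, hθ⟩ := exp_le_exp_mul_cosh_add (s := γ ^ 2 / 4) (by positivity)
  set b := max (max a a') 0 with hb
  have hab : a ≤ b := (le_max_left _ _).trans (le_max_left _ _)
  have hab' : a' ≤ b := (le_max_right _ _).trans (le_max_left _ _)
  have hb2 : b < 1 / 2 := max_lt (max_lt ha2 ha2') (by norm_num)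
  have hd : 0 < 1 / (1 - 2 * a) := one_div_pos.2 (by linarith)
  have hd' : 0 < 1 / (1 - 2 * a') := one_div_pos.2 (by linarith)
  set v := 1 / (1 - 2 * a) + 1 / (1 - 2 * a') + 1 with hv
  have hv0 : 0 < v := by positivity
  have hK0 : (0 : ℝ) < K := by positivity
  have hlogK : 0 < Real.log K := Real.log_pos (by exact_mod_cast hK)
  have hpow : Tendsto (fun k : ℕ => K ^ k) atTop atTop :=
    tendsto_pow_atTop_atTop_of_one_lt (by omega)
  have hpow1 : Tendsto (fun k : ℕ => K ^ (k + 1)) atTop atTop :=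
    hpow.comp (tendsto_add_atTop_nat 1)
  have hvar : ∀ᶠ m : ℕ in atTop, ∀ j ≥ m, blockVar a 1 j ≤ v * j ∧ blockVar a' 1 j ≤ v * j := by
    refine eventually_forall_ge_atTop.2 ?_
    filter_upwards [eventually_combo_blockVar_lt (α := 1) (β := 0) (v := v) ha ha2 ha' ha2'
      (by rw [hv]; linarith),
      eventually_combo_blockVar_lt (α := 0) (β := 1) (v := v) ha ha2 ha' ha2'
      (by rw [hv]; linarith)] with j h1 h2
    constructor <;> linarith
  filter_upwards [hV, hpow.eventually hvar,
    hpow1.eventually (eventually_mul_exp_neg_le (c := γ ^ 2 / (32 * v) / K) (s := 8 * (1 - κ))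
      (by positivity) (by linarith)),
    hpow1.eventually (eventually_rpow_mul_log_log_le hb2 (2 * Real.exp 1 ^ 2) (by positivity)
      (ε := θ₀ ^ 2 * v₀) (by positivity)),
    hpow1.eventually (tendsto_log_log_natCast.eventually_ge_atTop (12 / (γ ^ 2 * (1 - κ)))),
    hpow1.eventually (eventually_ge_atTop 3)] with k hVk hvk hexp hcoef hL hN3 C hC hCG
  have hlogN : Real.log ((K ^ (k + 1) : ℕ) : ℝ) = (k + 1) * Real.log K := by
    push_cast
    rw [Real.log_pow]
    push_cast
    ring
  have hm : 1 ≤ K ^ k := Nat.one_le_pow _ _ (by omega)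
  have hmN : K ^ k ≤ K ^ (k + 1) := Nat.pow_le_pow_right (by omega) k.le_succ
  have hNm : ((K ^ (k + 1) : ℕ) : ℝ) = ((K ^ k : ℕ) : ℝ) * K := by push_cast; ring
  set m := K ^ k with hmdef
  set N := K ^ (k + 1) with hNdef
  have hm0 : (0 : ℝ) < m := by exact_mod_cast hm
  have hN0 : (0 : ℝ) < N := by positivity
  have hlog1 := one_le_log_natCast hN3
  set L := Real.log (Real.log N) with hLdef
  have hL0 : 0 ≤ L := Real.log_nonneg hlog1
  set V := blockVar a m N + blockVar a' m N with hVdef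
  have hV0 : 0 < V := (by positivity : 0 < v₀ * N).trans_le hVk
  set W := 2 * (1 - κ) * L with hWdef
  have hκ1' : 0 < 1 - κ := sub_pos.2 hκ1
  have hW0 : 0 ≤ W := by positivity
  set f : Ω → ℝ := C.indicator 1 with hf
  have hCm : MeasurableSet C := by
    have := (hC.measurable hY.measurable)
    exact measurableSet_setOfPred.2 this
  have hfp : Past (interleave X X') (2 * m) f := by
    intro ω ω' h
    have := hC ω ω' h
    simp only [eq_iff_iff] at this
    by_cases hω : ω ∈ C
    · simp [hf, hω, this.1 hω]
    · simp [hf, hω, mt this.2 hω]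
  have hf0 : ∀ ω, 0 ≤ f ω := fun ω => Set.indicator_nonneg (fun _ _ => zero_le_one) ω
  have hfint : ∫ ω, f ω ∂P = P.real C := by rw [hf, integral_indicator_one hCm]
  have hsumV : ∑ i ∈ Finset.Ico (2 * m) (2 * N), innovCoef a a' 1 (-1) N i ^ 2 = V := by
    rw [sum_innovCoef_sq _ _ _ _ hmN, hVdef]
    ring
  have hr2 : Real.sqrt (W / V) ^ 2 * V = W := by
    rw [Real.sq_sqrt (by positivity), div_mul_cancel₀ _ hV0.ne']
  have hc : ∀ i ∈ Finset.Ico (2 * m) (2 * N),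
      |Real.sqrt (W / V) * innovCoef a a' 1 (-1) N i| ≤ θ₀ := by
    intro i hi
    refine abs_le_of_sq_le_sq ?_ hθ₀.le
    have h1 := abs_innovCoef_le ha ha' hab hab' (le_max_right _ _) (by linarith : b ≤ 1)
      (Finset.mem_Ico.1 hi).2
    have h2 : innovCoef a a' 1 (-1) N i ^ 2 ≤ (Real.exp 1 * (N : ℝ) ^ b) ^ 2 := by
      rw [← sq_abs]
      gcongr
    rw [mul_pow, Real.sq_sqrt (by positivity), div_mul_eq_mul_div, div_le_iff₀ hV0]
    calc W * innovCoef a a' 1 (-1) N i ^ 2 ≤ (2 * L) * (Real.exp 1 * (N : ℝ) ^ b) ^ 2 := by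
          refine mul_le_mul ?_ h2 (sq_nonneg _) (by positivity)
          rw [hWdef]
          nlinarith
      _ = 2 * Real.exp 1 ^ 2 * ((N : ℝ) ^ b) ^ 2 * L := by ring
      _ ≤ θ₀ ^ 2 * (v₀ * N) := by rw [← mul_assoc]; exact hcoef
      _ ≤ θ₀ ^ 2 * V := by gcongr
  have hWγ : 3 ≤ Real.exp (γ ^ 2 * W / 4) / 2 := by
    have h1 : 6 ≤ γ ^ 2 * W / 4 := by
      rw [div_le_iff₀ (by positivity)] at hL
      rw [hWdef]
      linarith
    have := Real.add_one_le_exp (γ ^ 2 * W / 4)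
    linarith
  have hR : ∫ ω in {ω | γ ^ 2 / 4 * V < ∑ i ∈ Finset.Ico (2 * m) (2 * N),
      innovCoef a a' 1 (-1) N i ^ 2 * interleave (drift a X) (drift a' X') i ω ^ 2}, f ω ∂P ≤
      Real.exp (-(4 * W)) * ∫ ω, f ω ∂P := by
    refine (hY.setIntegral_drift_large_le ha ha2 ha' ha2' hm hv0 hvk hγ0 hfp hf0 ?_ hsumV).trans ?_
    · intro ω hω
      have := hCG (Set.mem_of_indicator_ne_zero hω)
      rw [hγ, show κ / 4 / 16 = κ / 64 by ring]
      exact this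
    · refine mul_le_mul_of_nonneg_right ?_ (integral_nonneg hf0)
      have e1 : γ ^ 2 / (32 * v) / K * N = γ ^ 2 / (32 * v) * m := by
        rw [hNm]
        field_simp
      rw [e1] at hexp
      rw [hWdef, show 4 * (2 * (1 - κ) * L) = 8 * (1 - κ) * L by ring]
      exact hexp
  have main := hY.le_setIntegral_ge (by omega : 2 ≤ 2 * m) (by omega : 2 * m ≤ 2 * N) hfp hf0 hγ0
    (by rw [hγ]; linarith : γ ≤ 1) hθ (Real.sqrt_nonneg (W / V)) hc hsumV hr2 hWγ hR
  have hscale : Real.sqrt ((1 - κ) * v₀) * lilScale N ≤ Real.sqrt (W / V) * V := by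
    have e1 : Real.sqrt (W / V) * V = Real.sqrt (W * V) := by
      rw [show W * V = W / V * V ^ 2 by field_simp, Real.sqrt_mul (by positivity),
        Real.sqrt_sq hV0.le]
    rw [e1, lilScale, ← Real.sqrt_mul (by positivity)]
    refine Real.sqrt_le_sqrt ?_
    calc (1 - κ) * v₀ * (2 * N * Real.log (Real.log N)) = W * (v₀ * N) := by rw [hWdef]; ring
      _ ≤ W * V := by gcongr
  have hexpL : 1 / (Real.log K) * (1 / ((k : ℝ) + 1)) ≤
      Real.exp (-(W * (1 / 2 + γ + γ ^ 2 / 4))) := by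
    have e1 : Real.exp (-L) = 1 / (Real.log K) * (1 / ((k : ℝ) + 1)) := by
      rw [Real.exp_neg, hLdef, Real.exp_log (by linarith), hlogN, mul_inv, one_div, one_div,
        mul_comm]
    rw [← e1]
    refine Real.exp_le_exp.2 (neg_le_neg ?_)
    have : (1 - κ) * (1 + κ / 2 + κ ^ 2 / 32) ≤ 1 := by nlinarith [pow_pos hκ0 3, pow_pos hκ0 2]
    calc W * (1 / 2 + γ + γ ^ 2 / 4) = (1 - κ) * (1 + κ / 2 + κ ^ 2 / 32) * L := by
          rw [hWdef, hγ]; ring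
      _ ≤ 1 * L := by gcongr
      _ = L := one_mul _
  have hTm : Measurable fun ω => ∑ i ∈ Finset.Ico (2 * m) (2 * N), innovCoef a a' 1 (-1) N i *
      (interleave X X' i ω - interleave (drift a X) (drift a' X') i ω) :=
    (hY.past_sum (c := fun k _ => innovCoef a a' 1 (-1) N k) (n := 2 * N)
      (fun k => Past.const _) _ fun k hk => (Finset.mem_Ico.1 hk).2).measurable hY.measurable
  rw [hfint] at main
  calc 1 / (2 * Real.log K) * (1 / ((k : ℝ) + 1)) * P.real C
      = 1 / (Real.log K) * (1 / ((k : ℝ) + 1)) / 2 * P.real C := by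
        field_simp
    _ ≤ Real.exp (-(W * (1 / 2 + γ + γ ^ 2 / 4))) / 2 * P.real C := by gcongr
    _ ≤ _ := main
    _ = P.real (C ∩ {ω | (1 - γ) * (Real.sqrt (W / V) * V) ≤ ∑ i ∈ Finset.Ico (2 * m) (2 * N),
          innovCoef a a' 1 (-1) N i *
            (interleave X X' i ω - interleave (drift a X) (drift a' X') i ω)}) := by
        rw [hf, setIntegral_indicator hCm, Set.inter_comm]
        simp
    _ ≤ _ := by
        refine measureReal_mono (Set.inter_subset_inter_right _ fun ω hω => ?_)
        rw [Set.mem_ofPred_eq] at hω ⊢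
        exact (mul_le_mul_of_nonneg_left hscale (by rw [hγ]; linarith)).trans hω

end

lemma eventually_lilScale_le_mul {C ε : ℝ} (hε : 0 < ε) :
    ∀ᶠ n : ℕ in atTop, C * lilScale n ≤ ε * n := by
  filter_upwards [eventually_rpow_mul_log_log_le (b := 0) (by norm_num) (2 * C ^ 2) (by positivity)
    (ε := ε ^ 2) (by positivity), eventually_ge_atTop 3] with n h1 hn
  rw [Real.rpow_zero, one_pow, mul_one] at h1
  have hn0 : (0 : ℝ) ≤ n := n.cast_nonneg
  refine (le_abs_self _).trans (abs_le_of_sq_le_sq ?_ (by positivity))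
  rw [mul_pow, lilScale_sq hn]
  nlinarith

lemma sqrt_mul_lilScale_le {K m : ℕ} (hm : 3 ≤ m) (hK : 1 ≤ K) :
    Real.sqrt K * lilScale m ≤ lilScale (m * K) := by
  have h1 := one_le_log_natCast hm
  have hmK : (m : ℝ) ≤ ((m * K : ℕ) : ℝ) := by
    exact_mod_cast Nat.le_mul_of_pos_right m hK
  rw [lilScale, lilScale, ← Real.sqrt_mul K.cast_nonneg]
  refine Real.sqrt_le_sqrt ?_
  have h2 : Real.log (Real.log m) ≤ Real.log (Real.log ((m * K : ℕ) : ℝ)) :=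
    Real.log_le_log (by linarith) (Real.log_le_log (by positivity) hmK)
  calc (K : ℝ) * (2 * m * Real.log (Real.log m))
      = 2 * ((m * K : ℕ) : ℝ) * Real.log (Real.log m) := by
        push_cast; ring
    _ ≤ _ := by gcongr

lemma past_walk {Ω : Type*} (X : ℕ → Ω → ℤ) (n : ℕ) : Past X n (walk X n) :=
  Past.sum fun _ hi => (Past.term (Finset.mem_range.1 hi)).comp fun z : ℤ => (z : ℝ)

/-- The initial position contributes little at the end of a long geometric block. -/
lemma growth_div_mul_abs_walk_le {Ω : Type*} {X : ℕ → Ω → ℤ} {a b D : ℝ} (ha : -1 < a)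
    (hab : a ≤ b) (hb0 : 0 ≤ b) (hb1 : b ≤ 1) (hD : 0 ≤ D) {K m : ℕ} (hm : 3 ≤ m) (hK : 1 ≤ K)
    {ω : Ω} (h : |walk X m ω| ≤ D * lilScale m) :
    |growth a (m * K) / growth a m * walk X m ω| ≤
      Real.exp 1 * D * (K : ℝ) ^ (-(1 / 2 - b)) * lilScale (m * K) := by
  have hm0 : (0 : ℝ) < m := by positivity
  have hK0 : (0 : ℝ) < K := by positivity
  have hg := growth_div_le ha hab hb0 hb1 (by omega : 1 ≤ m) (Nat.le_mul_of_pos_right m hK)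
  rw [Nat.cast_mul, mul_div_cancel_left₀ _ hm0.ne'] at hg
  have hs := sqrt_mul_lilScale_le hm hK
  have hpow : (K : ℝ) ^ b = (K : ℝ) ^ (-(1 / 2 - b)) * Real.sqrt K := by
    rw [Real.sqrt_eq_rpow, ← Real.rpow_add hK0]
    congr 1
    ring
  rw [abs_mul, abs_of_pos (div_pos (growth_pos ha _) (growth_pos ha _))]
  have hstep : growth a (m * K) / growth a m * |walk X m ω| ≤
      Real.exp 1 * D * (K : ℝ) ^ (-(1 / 2 - b)) * (Real.sqrt K * lilScale m) := by
    calc _ ≤ (Real.exp 1 * (K : ℝ) ^ b) * (D * lilScale m) :=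
          mul_le_mul hg h (abs_nonneg _) (by positivity)
      _ = _ := by rw [hpow]; ring
  refine hstep.trans ?_
  gcongr

theorem ae_frequently_le_walk_sub_walk {Ω : Type*} [MeasurableSpace Ω] {P : Measure Ω}
    [IsProbabilityMeasure P] {X X' : ℕ → Ω → ℤ} {a a' : ℝ}
    (hY : IsSignSequence P 2 (interleave X X') (interleave (drift a X) (drift a' X')))
    (hX : ∀ n ω, X n ω = 1 ∨ X n ω = -1) (hX' : ∀ n ω, X' n ω = 1 ∨ X' n ω = -1)
    (ha : -1 < a) (ha2 : a < 1 / 2) (ha' : -1 < a') (ha2' : a' < 1 / 2) {τ : ℝ}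
    (hτ : τ < Real.sqrt (1 / (1 - 2 * a) + 1 / (1 - 2 * a'))) :
    ∀ᵐ ω ∂P, ∃ᶠ n in atTop, τ * lilScale n ≤ walk X n ω - walk X' n ω := by
  have hd : 0 < 1 / (1 - 2 * a) := one_div_pos.2 (by linarith)
  have hd' : 0 < 1 / (1 - 2 * a') := one_div_pos.2 (by linarith)
  set d := 1 / (1 - 2 * a) with hddef
  set d' := 1 / (1 - 2 * a') with hddef'
  obtain ⟨τ₁, hτ₁, hτ₁'⟩ := exists_between
    (max_lt hτ (Real.sqrt_pos.2 (by positivity)) : max τ 0 < Real.sqrt (d + d'))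
  have hττ₁ : τ < τ₁ := (le_max_left _ _).trans_lt hτ₁
  have hτ₁0 : 0 < τ₁ := (le_max_right _ _).trans_lt hτ₁
  obtain ⟨v₀, hv₀, hv₀'⟩ := exists_between ((Real.lt_sqrt hτ₁0.le).1 hτ₁')
  have hv₀0 : 0 < v₀ := (sq_nonneg τ₁).trans_lt hv₀
  obtain ⟨κ, hκτ, hκ1, hκ0⟩ : ∃ κ : ℝ, τ₁ ≤ (1 - κ / 4) * Real.sqrt ((1 - κ) * v₀) ∧ κ < 1 ∧
      0 < κ := by
    have hcont : ContinuousAt (fun κ : ℝ => (1 - κ / 4) * Real.sqrt ((1 - κ) * v₀)) 0 := by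
      fun_prop
    have h0 : τ₁ < (1 - (0 : ℝ) / 4) * Real.sqrt ((1 - 0) * v₀) := by
      simpa using (Real.lt_sqrt hτ₁0.le).2 hv₀
    have h1 := (hcont.tendsto.eventually_const_le h0).and (eventually_lt_nhds (zero_lt_one' ℝ))
    obtain ⟨κ, ⟨h2, h3⟩, h4⟩ :=
      ((h1.filter_mono nhdsWithin_le_nhds).and (self_mem_nhdsWithin (s := Set.Ioi (0 : ℝ)))).exists
    exact ⟨κ, h2, h3, h4⟩
  set b := max (max a a') 0 with hb
  have hab : a ≤ b := (le_max_left _ _).trans (le_max_left _ _)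
  have hab' : a' ≤ b := (le_max_right _ _).trans (le_max_left _ _)
  have hb0 : 0 ≤ b := le_max_right _ _
  have hb2 : b < 1 / 2 := max_lt (max_lt ha2 ha2') (by norm_num)
  set v := d + d' + 1 with hv
  have hKlim : Tendsto (fun K : ℕ => 2 * Real.exp 1 * Real.sqrt v * (K : ℝ) ^ (-(1 / 2 - b))) atTop
      (nhds 0) := by
    have := ((tendsto_rpow_neg_atTop (by linarith : 0 < 1 / 2 - b)).comp
      tendsto_natCast_atTop_atTop).const_mul (2 * Real.exp 1 * Real.sqrt v)
    rwa [mul_zero] at this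
  obtain ⟨K, ⟨⟨hKτ, hK2⟩, hKa⟩, hKa'⟩ := (((hKlim.eventually_le_const (sub_pos.2 hττ₁)).and
    (eventually_ge_atTop 2)).and
    (eventually_blockVar_pow_ge ha ha2 (v := d - (d + d' - v₀) / 2) (by linarith))).and
    (eventually_blockVar_pow_ge ha' ha2' (v := d' - (d + d' - v₀) / 2) (by linarith)) |>.exists
  have hblock : ∀ᶠ k : ℕ in atTop, v₀ * ((K ^ (k + 1) : ℕ) : ℝ) ≤
      blockVar a (K ^ k) (K ^ (k + 1)) + blockVar a' (K ^ k) (K ^ (k + 1)) := by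
    filter_upwards [hKa, hKa'] with k h1 h2
    linarith
  have hpow : Tendsto (fun k : ℕ => K ^ k) atTop atTop :=
    tendsto_pow_atTop_atTop_of_one_lt (by omega)
  have hpow1 : Tendsto (fun k : ℕ => K ^ (k + 1)) atTop atTop :=
    hpow.comp (tendsto_add_atTop_nat 1)
  have hlogK : 0 < Real.log K := Real.log_pos (by exact_mod_cast hK2)
  have hlog : ∀ᶠ k : ℕ in atTop, Real.log K * k ≤ Real.log ((K ^ k : ℕ) : ℝ) :=
    Eventually.of_forall fun k => by
      push_cast
      rw [Real.log_pow, mul_comm]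
  obtain ⟨k₁, hk₁⟩ := eventually_atTop.1
    (hY.eventually_le_measureReal_block ha ha2 ha' ha2' hK2 hκ0 hκ1 hv₀0 hblock)
  have hTp : ∀ k, Past (interleave X X') (2 * K ^ (k + 1)) fun ω =>
      ∑ i ∈ Finset.Ico (2 * K ^ k) (2 * K ^ (k + 1)), innovCoef a a' 1 (-1) (K ^ (k + 1)) i *
        (interleave X X' i ω - interleave (drift a X) (drift a' X') i ω) := fun k =>
    hY.past_sum (c := fun i _ => innovCoef a a' 1 (-1) (K ^ (k + 1)) i) (fun i => Past.const _) _
      fun i hi => (Finset.mem_Ico.1 hi).2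
  have hfreq := ae_frequently_of_past hY.measurable (ν := fun k => 2 * K ^ k)
    (fun i j hij => Nat.mul_le_mul_left 2 (Nat.pow_le_pow_right (by omega) hij))
    (fun k ω ω' h => by
      have := hTp k ω ω' h
      simp only at this
      simp only [Set.mem_ofPred_eq]
      rw [this])
    (fun k ω ω' h => by
      simp only [Set.mem_ofPred_eq]
      rw [past_interleave_left (past_walk X (K ^ k)) ω ω' h,
        past_interleave_right (past_walk X' (K ^ k)) ω ω' h]) hk₁ (by
      simp only [← Finset.mul_sum]
      exact Real.tendsto_sum_range_one_div_nat_succ_atTop.const_mul_atTop (by positivity))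
  filter_upwards [hfreq,
    hY.ae_eventually_abs_combo_le hX hX' ha ha2 ha' ha2' (α := 1) (β := 0) (v := v)
      (by rw [hv, ← hddef, ← hddef']; linarith) hpow hlogK hlog,
    hY.ae_eventually_abs_combo_le hX hX' ha ha2 ha' ha2' (α := 0) (β := 1) (v := v)
      (by rw [hv, ← hddef, ← hddef']; linarith) hpow hlogK hlog] with ω hω h1 h2
  simp only [one_mul, zero_mul, add_zero, zero_add] at h1 h2
  have hsmall := hpow.eventually
    (eventually_lilScale_le_mul (C := Real.sqrt v) (ε := κ / 64) (by positivity))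
  have hE := hω (by
    filter_upwards [h1, h2, hsmall] with k g1 g2 g3
    exact ⟨g1.trans g3, g2.trans g3⟩)
  refine hpow1.frequently ?_
  refine (hE.and_eventually ((h1.and h2).and (hpow.eventually (eventually_ge_atTop 3)))).mono ?_
  rintro k ⟨hEk, ⟨g1, g2⟩, hm3⟩
  have hN : K ^ (k + 1) = K ^ k * K := pow_succ K k
  have hmN : K ^ k ≤ K ^ (k + 1) := Nat.pow_le_pow_right (by omega) k.le_succ
  have e := combo_eq ha ha' X X' 1 (-1) hmN ω
  have r1 := growth_div_mul_abs_walk_le ha hab hb0 (by linarith) (Real.sqrt_nonneg v) hm3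
    (by omega : 1 ≤ K) g1
  have r2 := growth_div_mul_abs_walk_le ha' hab' hb0 (by linarith) (Real.sqrt_nonneg v) hm3
    (by omega : 1 ≤ K) g2
  rw [← hN] at r1 r2
  have hl := lilScale_nonneg (K ^ (k + 1))
  have s1 := mul_le_mul_of_nonneg_right hKτ hl
  have s2 := mul_le_mul_of_nonneg_right hκτ hl
  have t1 := neg_abs_le (growth a (K ^ (k + 1)) / growth a (K ^ k) * walk X (K ^ k) ω)
  have t2 := le_abs_self (growth a' (K ^ (k + 1)) / growth a' (K ^ k) * walk X' (K ^ k) ω)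
  linarith

lemma eventually_lilScale_pos : ∀ᶠ n : ℕ in atTop, 0 < lilScale n := by
  filter_upwards [eventually_sqrt_le_lilScale, eventually_ge_atTop 1] with n h1 hn
  exact (Real.sqrt_pos.2 (by exact_mod_cast hn)).trans_le h1

lemma limsup_div_eq_of_forall {u s : ℕ → ℝ} {σ : ℝ} (hs : ∀ᶠ n in atTop, 0 < s n)
    (hup : ∀ τ > σ, ∀ᶠ n in atTop, u n ≤ τ * s n) (hlo : ∀ τ < σ, ∃ᶠ n in atTop, τ * s n ≤ u n) :
    limsup (fun n => u n / s n) atTop = σ := by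
  have hup' : ∀ τ > σ, ∀ᶠ n in atTop, u n / s n ≤ τ := fun τ hτ => by
    filter_upwards [hs, hup τ hτ] with n h1 h2
    exact (div_le_iff₀ h1).2 h2
  have hlo' : ∀ τ < σ, ∃ᶠ n in atTop, τ ≤ u n / s n := fun τ hτ =>
    ((hlo τ hτ).and_eventually hs).mono fun n h => (le_div_iff₀ h.2).2 h.1
  refine le_antisymm (le_of_forall_gt_imp_ge_of_dense fun τ hτ => ?_)
    (le_of_forall_lt_imp_le_of_dense fun τ hτ => ?_)
  · exact limsup_le_of_le (.of_frequently_ge (hlo' (σ - 1) (by linarith))) (hup' τ hτ)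
  · exact le_limsup_of_frequently_le (hlo' τ hτ)
      (isBoundedUnder_of_eventually_le (hup' (σ + 1) (by linarith)))

lemma ae_limsup_div_eq_of_forall {Ω : Type*} [MeasurableSpace Ω] {P : Measure Ω}
    {u : ℕ → Ω → ℝ} {s : ℕ → ℝ} {σ : ℝ} (hs : ∀ᶠ n in atTop, 0 < s n)
    (hup : ∀ τ > σ, ∀ᵐ ω ∂P, ∀ᶠ n in atTop, u n ω ≤ τ * s n)
    (hlo : ∀ τ < σ, ∀ᵐ ω ∂P, ∃ᶠ n in atTop, τ * s n ≤ u n ω) :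
    ∀ᵐ ω ∂P, limsup (fun n => u n ω / s n) atTop = σ := by
  have h1 : ∀ᵐ ω ∂P, ∀ j : ℕ, ∀ᶠ n in atTop, u n ω ≤ (σ + 1 / ((j : ℝ) + 1)) * s n :=
    ae_all_iff.2 fun j => hup _ (lt_add_of_pos_right _ (by positivity))
  have h2 : ∀ᵐ ω ∂P, ∀ j : ℕ, ∃ᶠ n in atTop, (σ - 1 / ((j : ℝ) + 1)) * s n ≤ u n ω :=
    ae_all_iff.2 fun j => hlo _ (sub_lt_self _ (by positivity))
  filter_upwards [h1, h2] with ω g1 g2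
  refine limsup_div_eq_of_forall hs (fun τ hτ => ?_) fun τ hτ => ?_
  · obtain ⟨j, hj⟩ := exists_nat_one_div_lt (sub_pos.2 hτ)
    filter_upwards [g1 j, hs] with n k1 k2
    exact k1.trans (mul_le_mul_of_nonneg_right (by linarith) k2.le)
  · obtain ⟨j, hj⟩ := exists_nat_one_div_lt (sub_pos.2 hτ)
    refine ((g2 j).and_eventually hs).mono fun n h => ?_
    exact (mul_le_mul_of_nonneg_right (by linarith) h.2.le).trans h.1

/-- One-sided law of the iterated logarithm for the difference of two independent walks. -/
lemma IsERW.ae_limsup_walk_sub_walk_eq {Ω : Type*} [MeasurableSpace Ω] {P : Measure Ω}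
    [IsProbabilityMeasure P] {p p' q q' : ℝ} (hp : 0 < p) (hp34 : p < 3 / 4) (hp' : 0 < p')
    (hp'34 : p' < 3 / 4) {X X' : ℕ → Ω → ℤ} (hX : IsERW P p q X) (hX' : IsERW P p' q' X')
    (hindep : IndepFun (fun ω n => X n ω) (fun ω n => X' n ω) P) :
    ∀ᵐ ω ∂P, limsup (fun n => (walk X n ω - walk X' n ω) / lilScale n) atTop =
      Real.sqrt (1 / (3 - 4 * p) + 1 / (3 - 4 * p')) := by
  have hY := isSignSequence_interleave hp.le (by linarith) hp'.le (by linarith) hX hX' hindep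
  have hY' := isSignSequence_interleave hp'.le (by linarith) hp.le (by linarith) hX' hX hindep.symm
  have e : 3 - 4 * p = 1 - 2 * (2 * p - 1) := by ring
  have e' : 3 - 4 * p' = 1 - 2 * (2 * p' - 1) := by ring
  rw [e, e']
  refine ae_limsup_div_eq_of_forall (u := fun n ω => walk X n ω - walk X' n ω)
    eventually_lilScale_pos (fun τ hτ => ?_) fun τ hτ => ?_
  · filter_upwards [ae_eventually_abs_walk_sub_walk_le hY hY' hX.2.1 hX'.2.1 (by linarith)
      (by linarith) (by linarith) (by linarith) hτ] with ω h
    exact h.mono fun n hn => (le_abs_self _).trans hn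
  · exact ae_frequently_le_walk_sub_walk hY hX.2.1 hX'.2.1 (by linarith) (by linarith)
      (by linarith) (by linarith) hτ

/-- Theorem 3: for two independent ERWs with memory parameters `0 < p < 3/4` and
`0 < p' < 3/4`, almost surely
`limsup_{n→∞} ±(S_n - S'_n)/√(2 n log log n) = √(1/(3-4p) + 1/(3-4p'))`. -/
theorem lil_two_erw_different_parameters {Ω : Type*} [MeasurableSpace Ω]
    (P : Measure Ω) [IsProbabilityMeasure P] (p p' q q' : ℝ)
    (hq0 : 0 ≤ q) (hq1 : q ≤ 1) (hq'0 : 0 ≤ q') (hq'1 : q' ≤ 1)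
    (hp : 0 < p) (hp34 : p < 3 / 4) (hp' : 0 < p') (hp'34 : p' < 3 / 4)
    (X X' : ℕ → Ω → ℤ) (hX : IsERW P p q X) (hX' : IsERW P p' q' X')
    (hindep : IndepFun (fun ω n => X n ω) (fun ω n => X' n ω) P)
    (S S' : ℕ → Ω → ℤ)
    (hS : ∀ n ω, S n ω = ∑ i ∈ Finset.range n, X i ω)
    (hS' : ∀ n ω, S' n ω = ∑ i ∈ Finset.range n, X' i ω) :
    ∀ᵐ ω ∂P,
      limsup (fun n : ℕ =>
          ((S n ω - S' n ω : ℤ) : ℝ)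
            / Real.sqrt (2 * n * Real.log (Real.log n))) atTop
        = Real.sqrt (1 / (3 - 4 * p) + 1 / (3 - 4 * p')) ∧
      limsup (fun n : ℕ =>
          ((S' n ω - S n ω : ℤ) : ℝ)
            / Real.sqrt (2 * n * Real.log (Real.log n))) atTop
        = Real.sqrt (1 / (3 - 4 * p) + 1 / (3 - 4 * p')) := by
  have hw : ∀ n ω, (S n ω : ℝ) = walk X n ω := fun n ω => by rw [hS, walk, Int.cast_sum]
  have hw' : ∀ n ω, (S' n ω : ℝ) = walk X' n ω := fun n ω => by rw [hS', walk, Int.cast_sum]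
  filter_upwards [hX.ae_limsup_walk_sub_walk_eq hp hp34 hp' hp'34 hX' hindep,
    hX'.ae_limsup_walk_sub_walk_eq hp' hp'34 hp hp34 hX hindep.symm] with ω h1 h2
  simp only [Int.cast_sub, hw, hw']
  exact ⟨h1, h2.trans (by rw [add_comm])⟩
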